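/- arXiv:2503.21052 — 3 statements merged into one kernel-verified Lean document; each statement's English description precedes it below -/
import Mathlib

section
/- Let G be a disperse ℓ-uniform hypergraph (ℓ ≥ 3) on at least ℓ vertices. Then G or its complement is not tightly connected. -/
open Finset

/-- An `ℓ`-uniform hypergraph (given by its edge set `E`) is disperse if every
`(ℓ+1)`-set of vertices induces `0`, `1`, `ℓ` or `ℓ+1` edges. -/
def Disperse {V : Type*} [DecidableEq V] (ℓ : ℕ) (E : Finset (Finset V)) : Prop :=
  ∀ X : Finset V, X.card = ℓ + 1 →
    (E.filter (· ⊆ X)).card = 0 ∨ (E.filter (· ⊆ X)).card = 1 ∨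
    (E.filter (· ⊆ X)).card = ℓ ∨ (E.filter (· ⊆ X)).card = ℓ + 1

/-- Edge set of the link of a vertex `v`: all `(ℓ-1)`-sets `e` with `e ∪ {v} ∈ E`. -/
def linkEdges {V : Type*} [DecidableEq V] (E : Finset (Finset V)) (v : V) :
    Finset (Finset V) :=
  (E.filter (fun e => v ∈ e)).image (fun e => e.erase v)

/-- `A` and `B` are connected by a tight walk in the `k`-uniform hypergraph with
edge set `E`: there is a sequence of edges, consecutive ones sharing at least
`k - 1` vertices, whose first edge contains `A` and last edge contains `B`. -/
def TightConn {V : Type*} [DecidableEq V] (k : ℕ) (E : Finset (Finset V))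
    (A B : Finset V) : Prop :=
  ∃ es : List (Finset V), ∃ h : es ≠ [],
    (∀ e ∈ es, e ∈ E) ∧ es.Chain' (fun a b => k - 1 ≤ (a ∩ b).card) ∧
    A ⊆ es.head h ∧ B ⊆ es.getLast h

/-- Two edges inside an `(ℓ+1)`-set force all but at most one of its `ℓ`-subsets to be edges. -/
def TwoForceAlmostAll {V : Type*} [DecidableEq V] (ℓ : ℕ) (E : Finset (Finset V)) : Prop :=
  ∀ X : Finset V, X.card = ℓ + 1 → ∀ x ∈ X, ∀ y ∈ X, ∀ p ∈ X, ∀ q ∈ X, x ≠ y → p ≠ q →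
    X.erase x ∈ E → X.erase y ∈ E → X.erase p ∈ E ∨ X.erase q ∈ E

/-- `A` and `B` are facets, both containing `T`, of a common edge. -/
def FacetStep {V : Type*} [DecidableEq V] (E : Finset (Finset V)) (T A B : Finset V) : Prop :=
  ∃ e ∈ E, T ⊆ e ∧ ∃ a ∈ e, ∃ b ∈ e, a ∉ T ∧ b ∉ T ∧ A = e.erase a ∧ B = e.erase b

/-- Tight connectivity inside the link of `T`. -/
abbrev FacetConn {V : Type*} [DecidableEq V] (E : Finset (Finset V)) (T : Finset V) :
    Finset V → Finset V → Prop :=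
  Relation.ReflTransGen (FacetStep E T)

/-- An `ℓ`-set two of whose facets are connected in the link of `T` is an edge, or there is a
vertex `u` all of whose exchanges into the set are edges. -/
def ConnFacetsSpan {V : Type*} [DecidableEq V] (ℓ : ℕ) (E : Finset (Finset V))
    (T : Finset V) : Prop :=
  ∀ B : Finset V, B.card = ℓ → T ⊆ B → ∀ b ∈ B, ∀ c ∈ B, b ∉ T → c ∉ T → b ≠ c →
    FacetConn E T (B.erase b) (B.erase c) →
    B ∈ E ∨ ∃ u ∉ B, ∀ d ∈ B, insert u (B.erase d) ∈ E

section

variable {V : Type*} [DecidableEq V] {ℓ : ℕ} {E : Finset (Finset V)}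

theorem Disperse.twoForceAlmostAll (hunif : ∀ e ∈ E, e.card = ℓ)
    (h : Disperse ℓ E) : TwoForceAlmostAll ℓ E := by
  intro X hX x hx y hy p hp q hq hxy hpq hEx hEy
  by_contra hcon
  push Not at hcon
  have herase : Set.InjOn X.erase (X : Set V) := Finset.erase_injOn X
  have hfil : E.filter (· ⊆ X) = (X.filter (fun z => X.erase z ∈ E)).image X.erase := by
    ext e
    simp only [mem_filter, mem_image]
    constructor
    · rintro ⟨he, heX⟩
      have hc : (X \ e).card = 1 := by
        rw [card_sdiff_of_subset heX, hX, hunif e he]; omega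
      obtain ⟨z, hz⟩ := card_eq_one.mp hc
      have hzm : z ∈ X \ e := by simp [hz]
      have heq : X.erase z = e := by
        rw [erase_eq, ← hz, Finset.sdiff_sdiff_eq_self heX]
      exact ⟨z, ⟨(mem_sdiff.mp hzm).1, heq ▸ he⟩, heq⟩
    · rintro ⟨z, ⟨hz, hzE⟩, rfl⟩
      exact ⟨hzE, erase_subset _ _⟩
  have hcard : (E.filter (· ⊆ X)).card = (X.filter (fun z => X.erase z ∈ E)).card := by
    rw [hfil]
    exact card_image_of_injOn (herase.mono (by
      intro z hz
      exact (mem_filter.mp hz).1))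
  have h2 : 2 ≤ (X.filter (fun z => X.erase z ∈ E)).card := by
    rw [← card_pair hxy]
    apply card_le_card
    intro z hz
    simp only [mem_insert, mem_singleton] at hz
    rcases hz with rfl | rfl <;> simp [*]
  have h3 : (X.filter (fun z => X.erase z ∈ E)).card ≤ ((X.erase p).erase q).card := by
    apply card_le_card
    intro z hz
    simp only [mem_filter, mem_erase] at hz ⊢
    refine ⟨?_, ?_, hz.1⟩ <;> rintro rfl
    · exact hcon.2 hz.2
    · exact hcon.1 hz.2
  rw [card_erase_of_mem (mem_erase.mpr ⟨hpq.symm, hq⟩), card_erase_of_mem hp] at h3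
  have := h X hX
  omega

theorem TwoForceAlmostAll.compl [Fintype V] (h : TwoForceAlmostAll ℓ E) :
    TwoForceAlmostAll ℓ (Finset.univ.powersetCard ℓ \ E) := by
  intro X hX x hx y hy p hp q hq hxy hpq hEx hEy
  have hc : ∀ z ∈ X, X.erase z ∈ Finset.univ.powersetCard ℓ := by
    intro z hz
    simp [mem_powersetCard, card_erase_of_mem hz, hX]
  simp only [mem_sdiff] at *
  have := h X hX p hp q hq x hx y hy hpq hxy
  have := hc p hp
  have := hc q hq
  tauto

theorem FacetConn.symm {T A B : Finset V} (h : FacetConn E T A B) : FacetConn E T B A := by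
  induction h with
  | refl => exact .refl
  | tail _ hstep ih =>
    obtain ⟨e, he, hT, a, ha, b, hb, haT, hbT, rfl, rfl⟩ := hstep
    exact .head ⟨e, he, hT, b, hb, a, ha, hbT, haT, rfl, rfl⟩ ih

theorem FacetConn.exchange {T A e : Finset V} {a b : V} (h : FacetConn E T A (e.erase a))
    (he : e ∈ E) (hT : T ⊆ e) (ha : a ∈ e) (hb : b ∈ e) (haT : a ∉ T) (hbT : b ∉ T) :
    FacetConn E T A (e.erase b) :=
  h.tail ⟨e, he, hT, a, ha, b, hb, haT, hbT, rfl, rfl⟩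

/-- If `e` and one of its exchanges with `v` are edges, then connectivity in the link of
`insert v T` of one facet spreads to all facets of exchanges of `e` with `v`. -/
theorem facetConn_spread (hunif : ∀ e ∈ E, e.card = ℓ) (hD : TwoForceAlmostAll ℓ E)
    {T A e : Finset V} {v c b : V} (he : e ∈ E) (hT : T ⊆ e) (hve : v ∉ e)
    (hc : c ∈ e) (hcT : c ∉ T) (hb : b ∈ e) (hbT : b ∉ T) (hbc : b ≠ c)
    (hcE : insert v (e.erase c) ∈ E)
    (hA : FacetConn E (insert v T) A (insert v ((e.erase c).erase b)))
    {p q : V} (hp : p ∈ e) (hpT : p ∉ T) (hq : q ∈ e) (hqT : q ∉ T) (hpq : p ≠ q) :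
    FacetConn E (insert v T) A (insert v ((e.erase p).erase q)) := by
  have key : ∀ z ∈ e, z ∉ T → ∀ x ∈ e, x ∉ T → ∀ y ∈ e, y ∉ T → x ≠ z → y ≠ z →
      insert v (e.erase z) ∈ E →
      FacetConn E (insert v T) A (insert v ((e.erase z).erase x)) →
      FacetConn E (insert v T) A (insert v ((e.erase z).erase y)) := by
    intro z hz hzT x hx hxT y hy hyT hxz hyz hzE hconn
    have e1 : ∀ t ∈ e, insert v ((e.erase z).erase t) = (insert v (e.erase z)).erase t := by
      intro t ht
      have : v ≠ t := by rintro rfl; exact hve ht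
      rw [erase_insert_of_ne this]
    rw [e1 x hx] at hconn
    rw [e1 y hy]
    refine hconn.exchange hzE ?_ ?_ ?_ ?_ ?_ <;> grind
  have hc' : ∀ x ∈ e, x ∉ T → x ≠ c →
      FacetConn E (insert v T) A (insert v ((e.erase c).erase x)) := fun x hx hxT hxc =>
    key c hc hcT b hb hbT x hx hxT hbc hxc hcE hA
  by_cases hpc : p = c
  · subst hpc; exact hc' q hq hqT hpq.symm
  by_cases hqc : q = c
  · subst hqc; rw [erase_right_comm]; exact hc' p hp hpT hpc
  have ins : ∀ t ∈ e, (insert v e).erase t = insert v (e.erase t) := by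
    intro t ht
    have : v ≠ t := by rintro rfl; exact hve ht
    rw [erase_insert_of_ne this]
  have hcard : (insert v e).card = ℓ + 1 := by rw [card_insert_of_notMem hve, hunif e he]
  have := hD (insert v e) hcard v (by simp) c (by simp [hc]) p (by simp [hp]) q (by simp [hq])
    (by rintro rfl; exact hve hc) hpq (by rwa [erase_insert hve]) (by rwa [ins c hc])
  rw [ins p hp, ins q hq] at this
  rcases this with h | h
  · refine key p hp hpT c hc hcT q hq hqT (Ne.symm hpc) hpq.symm h ?_
    rw [erase_right_comm]; exact hc' p hp hpT hpc
  · rw [erase_right_comm]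
    refine key q hq hqT c hc hcT p hp hpT (Ne.symm hqc) hpq h ?_
    rw [erase_right_comm]; exact hc' q hq hqT hqc

/-- Facets of an edge `insert w A` avoiding `v` stay connected once those of `A` are. -/
theorem facetConn_of_edge (hunif : ∀ e ∈ E, e.card = ℓ) (hD : TwoForceAlmostAll ℓ E)
    {T A₀ A : Finset V} {v w : V} (hTcard : T.card + 3 ≤ ℓ)
    (hspan : ConnFacetsSpan ℓ E (insert v T))
    (hT : T ⊆ A) (hvA : v ∉ A) (hwA : w ∉ A) (hwT : w ∉ T) (hvT : v ∉ T) (hvw : v ≠ w)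
    (he : insert w A ∈ E)
    (hA : ∀ b ∈ A, b ∉ T → FacetConn E (insert v T) A₀ (insert v (A.erase b)))
    {p q : V} (hp : p ∈ insert w A) (hpT : p ∉ T) (hq : q ∈ insert w A) (hqT : q ∉ T)
    (hpq : p ≠ q) :
    FacetConn E (insert v T) A₀ (insert v (((insert w A).erase p).erase q)) := by
  have hAcard : A.card + 1 = ℓ := by rw [← hunif _ he, card_insert_of_notMem hwA]
  have hve : v ∉ insert w A := by simp [hvA, hvw]
  have hTe : T ⊆ insert w A := hT.trans (subset_insert _ _)
  obtain ⟨b, hb, b', hb', hbb'⟩ : ∃ b ∈ A \ T, ∃ b' ∈ A \ T, b ≠ b' := by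
    have : 1 < (A \ T).card := by rw [card_sdiff_of_subset hT]; omega
    obtain ⟨b, hb, b', hb', h⟩ := one_lt_card.mp this
    exact ⟨b, hb, b', hb', h⟩
  rw [mem_sdiff] at hb hb'
  by_cases hvAE : insert v A ∈ E
  · refine facetConn_spread hunif hD he hTe hve (mem_insert_self w A) hwT
      (mem_insert_of_mem hb.1) hb.2 ?_ ?_ ?_ hp hpT hq hqT hpq
    · rintro rfl; exact hwA hb.1
    · rwa [erase_insert hwA]
    · rw [erase_insert hwA]; exact hA b hb.1 hb.2
  have ins : ∀ t ∈ A, (insert v A).erase t = insert v (A.erase t) := by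
    intro t ht
    have : v ≠ t := by rintro rfl; exact hvA ht
    rw [erase_insert_of_ne this]
  have hconn : FacetConn E (insert v T) ((insert v A).erase b) ((insert v A).erase b') := by
    rw [ins b hb.1, ins b' hb'.1]
    exact (hA b hb.1 hb.2).symm.trans (hA b' hb'.1 hb'.2)
  have hne : ∀ t ∈ A, t ≠ v := by rintro t ht rfl; exact hvA ht
  obtain ⟨u, hu, huE⟩ := (hspan (insert v A) (by rw [card_insert_of_notMem hvA, hAcard])
    (insert_subset_insert v hT) b (by simp [hb.1]) b' (by simp [hb'.1])
    (by simp [hb.2, hne b hb.1]) (by simp [hb'.2, hne b' hb'.1]) hbb' hconn).resolve_left hvAE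
  have huv : u ≠ v := by rintro rfl; simp at hu
  have huA : u ∉ A := fun h => hu (mem_insert_of_mem h)
  have huAE : insert u A ∈ E := by
    have := huE v (by simp)
    rwa [erase_insert hvA] at this
  have huvE : ∀ t ∈ A, insert v (insert u (A.erase t)) ∈ E := by
    intro t ht
    have := huE t (by simp [ht])
    rwa [ins t ht, Finset.insert_comm] at this
  by_cases huw : u = w
  · subst huw
    refine facetConn_spread (c := b) (b := u) hunif hD he hTe hve (mem_insert_of_mem hb.1) hb.2
      (mem_insert_self u A) hwT ?_ ?_ ?_ hp hpT hq hqT hpq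
    · rintro rfl; exact huA hb.1
    · have := huvE b hb.1
      rwa [erase_insert_of_ne (by rintro rfl; exact huA hb.1)]
    · rw [erase_right_comm, erase_insert huA]; exact hA b hb.1 hb.2
  by_cases hpw : p = w
  · subst hpw
    rw [erase_insert hwA]
    exact hA q (by simpa [hpq.symm] using hq) hqT
  by_cases hqw : q = w
  · subst hqw
    rw [erase_right_comm, erase_insert hwA]
    exact hA p (by simpa [hpq] using hp) hpT
  have hpA : p ∈ A := by simpa [hpw] using hp
  have hqA : q ∈ A := by simpa [hqw] using hq
  have huT : u ∉ T := fun h => huA (hT h)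
  have through : ∀ x ∈ A, x ∉ T → ∀ y ∈ A, y ∉ T → x ≠ y →
      insert u ((insert w A).erase x) ∈ E →
      FacetConn E (insert v T) A₀ (insert v (((insert w A).erase x).erase y)) := by
    intro x hx hxT y hy hyT hxy hE
    have e1 : (insert u ((insert w A).erase x)).erase w = insert u (A.erase x) := by grind
    have e2 : ((insert u ((insert w A).erase x)).erase w).erase u = A.erase x := by grind
    have e3 : ((insert w A).erase x).erase y
        = ((insert u ((insert w A).erase x)).erase u).erase y := by grind
    rw [e3]
    refine facetConn_spread (c := w) (b := u) hunif hD hE ?_ ?_ ?_ hwT (mem_insert_self _ _) huT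
      huw ?_ ?_ (mem_insert_self _ _) huT ?_ hyT ?_
    · grind
    · grind
    · grind
    · rw [e1]; exact huvE x hx
    · rw [e2]; exact hA x hx hxT
    · grind
    · grind
  have huwA : u ∉ insert w A := by simp [huA, huw]
  have insu : ∀ t ∈ A, (insert u (insert w A)).erase t = insert u ((insert w A).erase t) := by
    intro t ht
    rw [erase_insert_of_ne (by rintro rfl; exact huA ht)]
  have := hD (insert u (insert w A)) (by rw [card_insert_of_notMem huwA, hunif _ he])
    u (by simp) w (by simp) p (by simp [hpA]) q (by simp [hqA]) huw hpq
    (by rwa [erase_insert huwA])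
    (by rwa [erase_insert_of_ne huw, erase_insert hwA])
  rw [insu p hpA, insu q hqA] at this
  rcases this with h | h
  · exact through p hpA hpT q hqA hqT hpq h
  · rw [erase_right_comm]
    exact through q hqA hqT p hpA hpT hpq.symm h

/-- Facets containing `v` that are connected in the link of `T` are connected in the link
of `insert v T`. -/
theorem FacetConn.insert (hunif : ∀ e ∈ E, e.card = ℓ) (hD : TwoForceAlmostAll ℓ E)
    {T A₀ B : Finset V} {v : V} (hTcard : T.card + 3 ≤ ℓ) (hvT : v ∉ T)
    (hspan : ConnFacetsSpan ℓ E (insert v T)) (hvA : v ∈ A₀) (hvB : v ∈ B)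
    (h : FacetConn E T A₀ B) : FacetConn E (insert v T) A₀ B := by
  suffices H : (v ∈ B → FacetConn E (Insert.insert v T) A₀ B) ∧
      (v ∉ B → ∀ b ∈ B, b ∉ T → FacetConn E (Insert.insert v T) A₀
        (Insert.insert v (B.erase b))) from H.1 hvB
  clear hvB
  induction h with
  | refl => exact ⟨fun _ => .refl, fun h => absurd hvA h⟩
  | tail _ hstep ih =>
    obtain ⟨e, he, hTe, a, ha, b, hb, haT, hbT, rfl, rfl⟩ := hstep
    by_cases hve : v ∈ e
    · have hTe' : Insert.insert v T ⊆ e := by grind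
      obtain ⟨x, hx, hxT, hxconn⟩ : ∃ x ∈ e, x ∉ Insert.insert v T ∧
          FacetConn E (Insert.insert v T) A₀ (e.erase x) := by
        by_cases hav : a = v
        · subst hav
          obtain ⟨c, hc⟩ : ((e.erase a) \ T).Nonempty := by
            rw [← card_pos]
            have := le_card_sdiff T (e.erase a)
            rw [card_erase_of_mem ha, hunif e he] at this
            omega
          rw [mem_sdiff, mem_erase] at hc
          refine ⟨c, hc.1.2, by simp [hc.1.1, hc.2], ?_⟩
          have := ih.2 (by simp) c (by simp [hc.1]) hc.2
          rwa [erase_right_comm, insert_erase (by simp [ha, hc.1.1.symm])] at this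
        · exact ⟨a, ha, by simp [hav, haT], ih.1 (by grind)⟩
      have all : ∀ y ∈ e, y ∉ Insert.insert v T →
          FacetConn E (Insert.insert v T) A₀ (e.erase y) := fun y hy hyT =>
        hxconn.exchange he hTe' hx hy hxT hyT
      refine ⟨fun hv => all b hb (by grind), fun hv c hc hcT => ?_⟩
      have hbv : b = v := by grind
      subst hbv
      have : Insert.insert b ((e.erase b).erase c) = e.erase c := by
        rw [erase_right_comm, insert_erase (by grind)]
      rw [this]
      exact all c (by grind) (by grind)
    · refine ⟨fun hv => absurd (erase_subset _ _ hv) hve, fun _ c hc hcT => ?_⟩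
      have hea : Insert.insert a (e.erase a) = e := insert_erase ha
      have key := facetConn_of_edge (A₀ := A₀) (A := e.erase a) (v := v) (w := a) (p := b) (q := c)
        hunif hD hTcard hspan (by grind) (by grind) (by simp) haT hvT (by grind)
        (by rwa [hea]) (ih.2 (by grind))
      rw [hea] at key
      exact key hb hbT (by grind) hcT (by grind)

/-- The link graph of an `(ℓ-2)`-set contains no induced path on four vertices. -/
theorem link_no_induced_path (hℓ : 3 ≤ ℓ) (hD : TwoForceAlmostAll ℓ E)
    {T : Finset V} (hT : T.card + 2 = ℓ) {a b c d : V}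
    (ha : a ∉ T) (hb : b ∉ T) (hc : c ∉ T) (hd : d ∉ T)
    (hab : a ≠ b) (hac : a ≠ c) (had : a ≠ d) (hbc : b ≠ c) (hbd : b ≠ d) (hcd : c ≠ d)
    (eab : insert a (insert b T) ∈ E) (ebc : insert b (insert c T) ∈ E)
    (ecd : insert c (insert d T) ∈ E) (eac : insert a (insert c T) ∉ E)
    (ebd : insert b (insert d T) ∉ E) (ead : insert a (insert d T) ∉ E) : False := by
  obtain ⟨t, ht⟩ : T.Nonempty := card_pos.mp (by omega)
  have card3 : ∀ x y z : V, x ∉ T → y ∉ T → z ∉ T → x ≠ y → x ≠ z → y ≠ z →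
      (insert x (insert y (insert z T))).card = ℓ + 1 := by
    intro x y z hx hy hz hxy hxz hyz
    rw [card_insert_of_notMem (by simp [*]), card_insert_of_notMem (by simp [*]),
      card_insert_of_notMem hz]
    omega
  have two : ∀ x y z : V, x ∉ T → y ∉ T → z ∉ T → x ≠ y → x ≠ z → y ≠ z →
      insert x (insert y T) ∈ E → insert y (insert z T) ∈ E → insert x (insert z T) ∉ E →
      (insert x (insert y (insert z T))).erase t ∈ E := by
    intro x y z hx hy hz hxy hxz hyz exy eyz exz
    have e1 : (insert x (insert y (insert z T))).erase z = insert x (insert y T) := by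
      clear * - hx hy hz hxy hxz hyz; grind
    have e2 : (insert x (insert y (insert z T))).erase x = insert y (insert z T) := by
      clear * - hx hy hz hxy hxz hyz; grind
    have e3 : (insert x (insert y (insert z T))).erase y = insert x (insert z T) := by
      clear * - hx hy hz hxy hxz hyz; grind
    refine (hD _ (card3 x y z hx hy hz hxy hxz hyz) z (by simp) x (by simp) y (by simp) t
      (by simp [ht]) hxz.symm (by rintro rfl; exact hy ht) (by rwa [e1]) (by rwa [e2])).resolve_left
      (by rwa [e3])
  have one : ∀ x y z : V, x ∉ T → y ∉ T → z ∉ T → x ≠ y → x ≠ z → y ≠ z →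
      insert x (insert y T) ∈ E → insert y (insert z T) ∉ E → insert x (insert z T) ∉ E →
      (insert x (insert y (insert z T))).erase t ∉ E := by
    intro x y z hx hy hz hxy hxz hyz exy eyz exz hcon
    have e1 : (insert x (insert y (insert z T))).erase z = insert x (insert y T) := by
      clear * - hx hy hz hxy hxz hyz; grind
    have e2 : (insert x (insert y (insert z T))).erase x = insert y (insert z T) := by
      clear * - hx hy hz hxy hxz hyz; grind
    have e3 : (insert x (insert y (insert z T))).erase y = insert x (insert z T) := by
      clear * - hx hy hz hxy hxz hyz; grind
    rcases hD _ (card3 x y z hx hy hz hxy hxz hyz) z (by simp) t (by simp [ht]) x (by simp) y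
      (by simp) (by rintro rfl; exact hz ht) hxy (by rwa [e1]) hcon with h | h
    · exact eyz (e2 ▸ h)
    · exact exz (e3 ▸ h)
  have h1 := two a b c ha hb hc hab hac hbc eab ebc eac
  have h2 := two b c d hb hc hd hbc hbd hcd ebc ecd ebd
  have h3 := one a b d ha hb hd hab had hbd eab ebd ead
  have h4 := one c d a hc hd ha hcd hac.symm had.symm ecd (by rwa [Finset.insert_comm])
    (by rwa [Finset.insert_comm])
  have f1 : (insert a (insert b (insert c (insert d (T.erase t))))).erase d
      = (insert a (insert b (insert c T))).erase t := by
    clear * - ha hb hc hd hab hac had hbc hbd hcd ht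
    ext s; by_cases s = t <;> grind
  have f2 : (insert a (insert b (insert c (insert d (T.erase t))))).erase a
      = (insert b (insert c (insert d T))).erase t := by
    clear * - ha hb hc hd hab hac had hbc hbd hcd ht
    ext s; by_cases s = t <;> grind
  have f3 : (insert a (insert b (insert c (insert d (T.erase t))))).erase c
      = (insert a (insert b (insert d T))).erase t := by
    clear * - ha hb hc hd hab hac had hbc hbd hcd ht
    ext s; by_cases s = t <;> grind
  have f4 : (insert a (insert b (insert c (insert d (T.erase t))))).erase b
      = (insert c (insert d (insert a T))).erase t := by
    clear * - ha hb hc hd hab hac had hbc hbd hcd ht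
    ext s; by_cases s = t <;> grind
  have hcard : (insert a (insert b (insert c (insert d (T.erase t))))).card = ℓ + 1 := by
    rw [card_insert_of_notMem (by simp [*]), card_insert_of_notMem (by simp [*]),
      card_insert_of_notMem (by simp [*]), card_insert_of_notMem (by simp [*]),
      card_erase_of_mem ht]
    omega
  rcases hD _ hcard d (by simp) a (by simp) c (by simp) b (by simp) had.symm hbc.symm
    (by rwa [f1]) (by rwa [f2]) with h | h
  · exact h3 (f3 ▸ h)
  · exact h4 (f4 ▸ h)

/-- A step in the link of an `(ℓ-2)`-set is an edge of its link graph. -/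
theorem FacetStep.exists_link_edge {T B : Finset V} {y : V} (hy : y ∉ T)
    (h : FacetStep E T (insert y T) B) :
    ∃ z ∉ T, B = insert z T ∧ (z = y ∨ z ≠ y ∧ insert y (insert z T) ∈ E) := by
  obtain ⟨e, he, hTe, a, ha, b, hb, haT, hbT, h1, rfl⟩ := h
  have he' : e = insert a (insert y T) := by rw [h1, insert_erase ha]
  have hay : a ≠ y := by
    intro h
    have : y ∈ e.erase a := h1 ▸ mem_insert_self _ _
    simp [h] at this
  have hb' : b = a ∨ b = y := by grind
  rcases hb' with rfl | rfl
  · exact ⟨y, hy, h1.symm, .inl rfl⟩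
  · refine ⟨a, haT, by grind, .inr ⟨hay, ?_⟩⟩
    rwa [Finset.insert_comm, ← he']

theorem connFacetsSpan_of_card_add_two (hℓ : 3 ≤ ℓ)
    (hD : TwoForceAlmostAll ℓ E) {T : Finset V} (hT : T.card + 2 = ℓ) :
    ConnFacetsSpan ℓ E T := by
  have hpath : ∀ x ∉ T, ∀ A, FacetConn E T (insert x T) A → ∃ y ∉ T, A = insert y T ∧
      (y = x ∨ y ≠ x ∧ insert x (insert y T) ∈ E ∨ y ≠ x ∧ ∃ u ∉ T, u ≠ x ∧ u ≠ y ∧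
        insert x (insert u T) ∈ E ∧ insert u (insert y T) ∈ E) := by
    intro x hx A h
    induction h with
    | refl => exact ⟨x, hx, rfl, .inl rfl⟩
    | tail _ hstep ih =>
      obtain ⟨y, hy, rfl, hxy⟩ := ih
      obtain ⟨z, hz, rfl, hyz⟩ := hstep.exists_link_edge hy
      refine ⟨z, hz, rfl, ?_⟩
      rcases hyz with rfl | ⟨hzy, eyz⟩
      · exact hxy
      by_cases hzx : z = x
      · exact .inl hzx
      rcases hxy with rfl | ⟨hyx, exy⟩ | ⟨hyx, u, hu, hux, huy, exu, euy⟩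
      · exact .inr (.inl ⟨hzy, eyz⟩)
      · exact .inr (.inr ⟨hzx, y, hy, hyx, hzy.symm, exy, eyz⟩)
      by_cases exz : insert x (insert z T) ∈ E
      · exact .inr (.inl ⟨hzx, exz⟩)
      by_cases exy : insert x (insert y T) ∈ E
      · exact .inr (.inr ⟨hzx, y, hy, hyx, hzy.symm, exy, eyz⟩)
      have hzu : u ≠ z := by rintro rfl; exact exz exu
      by_cases euz : insert u (insert z T) ∈ E
      · exact .inr (.inr ⟨hzx, u, hu, hux, hzu, exu, euz⟩)
      exact (link_no_induced_path hℓ hD hT hx hu hy hz hux.symm (Ne.symm hyx) (Ne.symm hzx) huy hzu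
        (Ne.symm hzy) exu euy eyz exy euz exz).elim
  intro B hB hTB b hb c hc hbT hcT hbc h
  have hTbc : B = insert b (insert c T) := by
    symm
    apply eq_of_subset_of_card_le
    · grind
    · rw [card_insert_of_notMem (by simp [*]), card_insert_of_notMem hcT]
      omega
  have e1 : B.erase b = insert c T := by grind
  have e2 : B.erase c = insert b T := by grind
  rw [e1, e2] at h
  obtain ⟨y, hy, hyb, hcase⟩ := hpath c hcT _ h
  have hby : b ∈ insert y T := hyb ▸ mem_insert_self b T
  obtain rfl : b = y := (mem_insert.mp hby).resolve_right hbT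
  rcases hcase with h | ⟨-, h⟩ | ⟨-, u, hu, huc, huy, ecu, euy⟩
  · exact absurd h hbc
  · left; rwa [hTbc, Finset.insert_comm]
  by_cases hBE : B ∈ E
  · exact .inl hBE
  right
  have huB : u ∉ B := by grind
  refine ⟨u, huB, fun d hd => ?_⟩
  have hud : u ≠ d := by rintro rfl; exact huB hd
  have f1 : (insert u B).erase b = insert c (insert u T) := by
    rw [erase_insert_of_ne huy, e1, Finset.insert_comm]
  have f2 : (insert u B).erase c = insert u (insert b T) := by
    rw [erase_insert_of_ne huc, e2]
  have := hD (insert u B) (by rw [card_insert_of_notMem huB, hB]) b (by simp [hb]) c (by simp [hc])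
    u (by simp) d (by simp [hd]) hbc hud (by rwa [f1]) (by rwa [f2])
  rw [erase_insert huB, erase_insert_of_ne hud] at this
  exact this.resolve_left hBE

theorem connFacetsSpan_of_card_le (hunif : ∀ e ∈ E, e.card = ℓ) (hℓ : 3 ≤ ℓ)
    (hD : TwoForceAlmostAll ℓ E) {T : Finset V} (hT : T.card + 2 ≤ ℓ) :
    ConnFacetsSpan ℓ E T := by
  obtain ⟨k, hk⟩ := Nat.exists_eq_add_of_le hT
  induction k generalizing T with
  | zero => exact connFacetsSpan_of_card_add_two hℓ hD (by omega)
  | succ k ih =>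
    intro B hB hTB b hb c hc hbT hcT hbc h
    obtain ⟨v, hv⟩ : (((B.erase b).erase c) \ T).Nonempty := by
      rw [← card_pos]
      have := le_card_sdiff T ((B.erase b).erase c)
      rw [card_erase_of_mem (by simp [hc, hbc.symm]), card_erase_of_mem hb] at this
      omega
    simp only [mem_sdiff, mem_erase] at hv
    obtain ⟨⟨hvc, hvb, hvB⟩, hvT⟩ := hv
    have hcard : (insert v T).card = T.card + 1 := card_insert_of_notMem hvT
    have hspan : ConnFacetsSpan ℓ E (insert v T) := ih (by omega) (by omega)
    exact hspan B hB (by grind) b hb c hc (by grind) (by grind) hbc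
      (h.insert hunif hD (by omega) hvT hspan (by grind) (by grind))

/-- Tight connectivity of facets containing `T` can be witnessed inside the link of `T`. -/
theorem FacetConn.of_empty (hunif : ∀ e ∈ E, e.card = ℓ) (hℓ : 3 ≤ ℓ)
    (hD : TwoForceAlmostAll ℓ E) {T A B : Finset V} (hT : T.card + 2 ≤ ℓ)
    (hA : T ⊆ A) (hB : T ⊆ B) (h : FacetConn E ∅ A B) : FacetConn E T A B := by
  induction T using Finset.induction_on with
  | empty => exact h
  | insert v T hvT ih =>
    have hcard : (Insert.insert v T).card = T.card + 1 := card_insert_of_notMem hvT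
    have hc := ih (by omega) ((subset_insert _ _).trans hA) ((subset_insert _ _).trans hB)
    exact hc.insert hunif hD (by omega) hvT (connFacetsSpan_of_card_le hunif hℓ hD hT)
      (hA (mem_insert_self _ _)) (hB (mem_insert_self _ _))

theorem TightConn.facetConn (hunif : ∀ e ∈ E, e.card = ℓ) (hℓ : 1 ≤ ℓ) {A B : Finset V}
    (hA : A.card = ℓ - 1) (hB : B.card = ℓ - 1) (h : TightConn ℓ E A B) :
    FacetConn E ∅ A B := by
  have facet : ∀ e ∈ E, ∀ S ⊆ e, S.card = ℓ - 1 → ∃ a ∈ e, S = e.erase a := by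
    intro e he S hS hc
    have h1 : (e \ S).card = 1 := by rw [card_sdiff_of_subset hS, hunif e he]; omega
    obtain ⟨z, hz⟩ := card_eq_one.mp h1
    have hzm : z ∈ e \ S := by simp [hz]
    exact ⟨z, (mem_sdiff.mp hzm).1, by rw [erase_eq, ← hz, Finset.sdiff_sdiff_eq_self hS]⟩
  have step : ∀ e ∈ E, ∀ S ⊆ e, ∀ S' ⊆ e, S.card = ℓ - 1 → S'.card = ℓ - 1 →
      FacetStep E ∅ S S' := by
    intro e he S hS S' hS' hc hc'
    obtain ⟨a, ha, h1⟩ := facet e he S hS hc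
    obtain ⟨b, hb, h2⟩ := facet e he S' hS' hc'
    exact ⟨e, he, empty_subset _, a, ha, b, hb, notMem_empty _, notMem_empty _, h1, h2⟩
  obtain ⟨es, hne, hE, hch, hAe, hBe⟩ := h
  induction es generalizing A with
  | nil => exact absurd rfl hne
  | cons e es ih =>
    cases es with
    | nil => exact .single (step e (hE e (by simp)) A hAe B hBe hA hB)
    | cons f es =>
      have hch' := List.isChain_cons_cons.mp hch
      obtain ⟨S, hS, hSc⟩ := exists_subset_card_eq hch'.1
      refine .head (step e (hE e (by simp)) A hAe S (hS.trans inter_subset_left) hA hSc) ?_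
      exact ih hSc (by simp) (fun g hg => hE g (by simp [hg])) hch'.2
        (hS.trans inter_subset_right) (by simpa using hBe)

end

section

variable {V : Type*}

/-- `r` has no induced path on four distinct vertices inside `W`. -/
def NoInducedPath (r : V → V → Prop) (W : Finset V) : Prop :=
  ∀ a ∈ W, ∀ b ∈ W, ∀ c ∈ W, ∀ d ∈ W, a ≠ b → a ≠ c → a ≠ d → b ≠ c → b ≠ d → c ≠ d →
    r a b → r b c → r c d → r a c ∨ r b d ∨ r a d

theorem NoInducedPath.compl {r : V → V → Prop} (hr : ∀ x y, r x y → r y x) {W : Finset V}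
    (h : NoInducedPath r W) : NoInducedPath (fun x y => ¬ r x y) W := by
  intro a ha b hb c hc d hd hab hac had hbc hbd hcd nab nbc ncd
  have := h b hb d hd a ha c hc hbd hab.symm hbc had.symm hcd.symm hac
  have := hr a b
  have := hr d c
  have := hr a d
  grind

variable [DecidableEq V]

/-- `W` has a nontrivial bipartition with no pair across related by `r`. -/
def HasSplit (r : V → V → Prop) (W : Finset V) : Prop :=
  ∃ X ⊆ W, X.Nonempty ∧ (W \ X).Nonempty ∧ ∀ x ∈ X, ∀ y ∈ W \ X, ¬ r x y

theorem HasSplit.insert {r : V → V → Prop} (hr : ∀ x y, r x y → r y x) {W : Finset V} {w : V}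
    (hw : w ∉ W) (hP : NoInducedPath r (insert w W)) (h : HasSplit r W) :
    HasSplit r (insert w W) ∨ HasSplit (fun x y => ¬ r x y) (insert w W) := by
  by_contra hcon
  rw [not_or] at hcon
  obtain ⟨hns, hnc⟩ := hcon
  have cross : ∀ Z ⊆ W, Z.Nonempty → ∃ z ∈ Z, ∃ t ∈ Insert.insert w W, t ∉ Z ∧ r z t := by
    intro Z hZ hne
    by_contra hno
    refine hns ⟨Z, hZ.trans (subset_insert _ _), hne, ⟨w, by grind⟩, ?_⟩
    intro x hx y hy hxy
    rw [mem_sdiff] at hy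
    exact hno ⟨x, hx, y, hy.1, hy.2, hxy⟩
  obtain ⟨y, hy, hwy⟩ : ∃ y ∈ W, ¬ r w y := by
    by_contra hall
    push Not at hall
    obtain ⟨X, hX, ⟨x, hx⟩, -⟩ := h
    refine hnc ⟨{w}, by simp, by simp, ⟨x, by grind⟩, ?_⟩
    intro a ha b hb
    grind
  obtain ⟨X, Y, hX, hY, hYne, hyX, hunion, hXY, hdisj⟩ : ∃ X Y : Finset V, X ⊆ W ∧ Y ⊆ W ∧
      Y.Nonempty ∧ y ∈ X ∧ (∀ x ∈ W, x ∈ X ∨ x ∈ Y) ∧ (∀ a ∈ X, ∀ b ∈ Y, ¬ r a b) ∧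
      ∀ a ∈ X, a ∉ Y := by
    obtain ⟨X, hX, hXne, hYne, hXY⟩ := h
    by_cases hyX : y ∈ X
    · exact ⟨X, W \ X, hX, sdiff_subset, hYne, hyX, by grind, hXY, by grind⟩
    · exact ⟨W \ X, X, sdiff_subset, hX, hXne, by grind, by grind,
        fun a ha b hb hab => hXY b hb a ha (hr _ _ hab), by grind⟩
  classical
  let Z := X.filter (Relation.ReflTransGen (fun a b => r a b ∧ ¬ r w b ∧ b ∈ X) y)
  have hZw : ∀ z ∈ Z, ¬ r w z := by
    intro z hz
    have hz' := (mem_filter.mp hz).2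
    cases hz' with
    | refl => exact hwy
    | tail _ h => exact h.2.1
  have hZX : Z ⊆ X := filter_subset _ _
  obtain ⟨z, hz, t, ht, htZ, hzt⟩ := cross Z (hZX.trans hX) ⟨y, mem_filter.mpr ⟨hyX, .refl⟩⟩
  have htw : t ≠ w := by rintro rfl; exact hZw z hz (hr _ _ hzt)
  have htW : t ∈ W := by grind
  have htX : t ∈ X := (hunion t htW).resolve_right fun h => hXY z (hZX hz) t h hzt
  have hwt : r w t := by
    by_contra hwt
    exact htZ (mem_filter.mpr ⟨htX, (mem_filter.mp hz).2.tail ⟨hzt, hwt, htX⟩⟩)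
  obtain ⟨s, hs, s', hs', hs'Y, hss'⟩ := cross Y hY hYne
  have hs'w : s' = w := by
    rcases mem_insert.mp hs' with h | h
    · exact h
    · exact absurd (hr _ _ hss') (hXY s' ((hunion s' h).resolve_right hs'Y) s hs)
  subst hs'w
  have hzX := hZX hz
  rcases hP s (by grind) s' hs' t ht z (by grind) (by grind) (by grind) (by grind) (by grind)
    (by grind) (by grind) hss' hwt (hr _ _ hzt) with h | h | h
  · exact hXY t htX s hs (hr _ _ h)
  · exact hZw z hz h
  · exact hXY z hzX s hs (hr _ _ h)

theorem NoInducedPath.hasSplit {r : V → V → Prop} (hr : ∀ x y, r x y → r y x) {W : Finset V}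
    (hW : 2 ≤ W.card) (hP : NoInducedPath r W) :
    HasSplit r W ∨ HasSplit (fun x y => ¬ r x y) W := by
  induction W using Finset.induction_on with
  | empty => simp at hW
  | insert w W hw ih =>
    by_cases h2 : 2 ≤ W.card
    · have hP' : NoInducedPath r W := by
        intro a ha b hb c hc d hd
        exact hP a (by simp [ha]) b (by simp [hb]) c (by simp [hc]) d (by simp [hd])
      rcases ih h2 hP' with h | h
      · exact h.insert hr hw hP
      · have := h.insert (fun x y hxy hyx => hxy (hr _ _ hyx)) hw (hP.compl hr)
        simp only [not_not] at this
        exact this.symm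
    · rw [card_insert_of_notMem hw] at hW
      obtain ⟨x, rfl⟩ := card_eq_one.mp (show W.card = 1 by omega)
      have hwx : w ≠ x := by simpa using hw
      by_cases h : r w x
      · right
        refine ⟨{w}, by simp, by simp, ⟨x, by simp [hwx.symm]⟩, ?_⟩
        intro a ha b hb
        grind
      · left
        refine ⟨{w}, by simp, by simp, ⟨x, by simp [hwx.symm]⟩, ?_⟩
        intro a ha b hb
        grind

/-- A split of the link graph of an `(ℓ-2)`-set obstructs tight connectivity. -/
theorem not_tightConn_of_hasSplit [Fintype V] {ℓ : ℕ} {E : Finset (Finset V)}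
    (hunif : ∀ e ∈ E, e.card = ℓ) (hℓ : 3 ≤ ℓ) (hD : TwoForceAlmostAll ℓ E) {T : Finset V}
    (hT : T.card + 2 = ℓ)
    (h : HasSplit (fun x y => insert x (insert y T) ∈ E) (univ \ T)) :
    ¬ ∀ A B : Finset V, A.card = ℓ - 1 → B.card = ℓ - 1 → TightConn ℓ E A B := by
  intro hconn
  obtain ⟨X, hX, ⟨x, hx⟩, ⟨y, hy⟩, hXY⟩ := h
  have hxT : x ∉ T := (mem_sdiff.mp (hX hx)).2
  have hyT : y ∉ T := by grind
  have hcard : ∀ z ∉ T, (insert z T).card = ℓ - 1 := by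
    intro z hz
    rw [card_insert_of_notMem hz]
    omega
  have hfc : FacetConn E T (insert x T) (insert y T) :=
    .of_empty hunif hℓ hD hT.le (subset_insert _ _) (subset_insert _ _)
      ((hconn _ _ (hcard x hxT) (hcard y hyT)).facetConn hunif (by omega) (hcard x hxT)
        (hcard y hyT))
  have hstay : ∀ A, FacetConn E T (insert x T) A → ∃ z ∈ X, A = insert z T := by
    intro A hA
    induction hA with
    | refl => exact ⟨x, hx, rfl⟩
    | tail _ hstep ih =>
      obtain ⟨z, hz, rfl⟩ := ih
      obtain ⟨t, ht, rfl, h⟩ := hstep.exists_link_edge (mem_sdiff.mp (hX hz)).2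
      rcases h with rfl | ⟨-, h⟩
      · exact ⟨t, hz, rfl⟩
      · by_cases htX : t ∈ X
        · exact ⟨t, htX, rfl⟩
        · exact absurd h (hXY z hz t (by simp [ht, htX]))
  obtain ⟨z, hz, hyz⟩ := hstay _ hfc
  have hyz' : y ∈ insert z T := hyz ▸ mem_insert_self y T
  obtain rfl : y = z := (mem_insert.mp hyz').resolve_right hyT
  exact (mem_sdiff.mp hy).2 hz

end

theorem not_tightly_connected {V : Type*} [DecidableEq V] [Fintype V]
    (ℓ : ℕ) (hℓ : 3 ≤ ℓ) (hn : ℓ ≤ Fintype.card V)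
    (E : Finset (Finset V)) (hunif : ∀ e ∈ E, e.card = ℓ) (hdisp : Disperse ℓ E) :
    ¬ (∀ A B : Finset V, A.card = ℓ - 1 → B.card = ℓ - 1 → TightConn ℓ E A B) ∨
    ¬ (∀ A B : Finset V, A.card = ℓ - 1 → B.card = ℓ - 1 →
        TightConn ℓ ((Finset.univ.powersetCard ℓ) \ E) A B) := by
  have hD := hdisp.twoForceAlmostAll hunif
  obtain ⟨T, -, hT⟩ := exists_subset_card_eq (s := (univ : Finset V)) (n := ℓ - 2)
    (by rw [card_univ]; omega)
  have hT2 : T.card + 2 = ℓ := by omega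
  have hW : 2 ≤ (univ \ T).card := by
    rw [card_sdiff_of_subset (subset_univ T), card_univ]
    omega
  have hP : NoInducedPath (fun x y => insert x (insert y T) ∈ E) (univ \ T) := by
    intro a ha b hb c hc d hd hab hac had hbc hbd hcd eab ebc ecd
    simp only [mem_sdiff, mem_univ, true_and] at ha hb hc hd
    by_contra hcon
    push Not at hcon
    exact link_no_induced_path hℓ hD hT2 ha hb hc hd hab hac had hbc hbd hcd eab ebc ecd
      hcon.1 hcon.2.1 hcon.2.2
  rcases hP.hasSplit (fun x y h => by rwa [Finset.insert_comm]) hW with h | h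
  · exact .inl (not_tightConn_of_hasSplit hunif hℓ hD hT2 h)
  · right
    refine not_tightConn_of_hasSplit ?_ hℓ hD.compl hT2 ?_
    · intro e he
      exact (mem_powersetCard.mp (mem_sdiff.mp he).1).2
    · obtain ⟨X, hX, hXne, hYne, hXY⟩ := h
      exact ⟨X, hX, hXne, hYne, fun x hx y hy hxy =>
        hXY x hx y hy (mem_sdiff.mp hxy).2⟩
end

section
/- Let G be a disperse ℓ-uniform hypergraph (ℓ ≥ 3). Then for every tight component C of G there exists a vertex set U ⊆ V(G) such that C is exactly the family of all (ℓ−1)-subsets of U. -/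
open Finset

/-- At most one of the sets obtained by deleting a vertex from a given `(n+1)`-set is a non-edge,
as soon as two of them are edges. -/
def ErasureClosed {V : Type*} [DecidableEq V] (n : ℕ) (E : Set (Finset V)) : Prop :=
  ∀ W : Finset V, W.card = n + 1 → ∀ a ∈ W, ∀ b ∈ W, ∀ c ∈ W, ∀ d ∈ W, a ≠ b → c ≠ d →
    W.erase a ∈ E → W.erase b ∈ E → W.erase c ∈ E ∨ W.erase d ∈ E

/-- The link of a vertex, as a set of finsets. -/
def vertexLink {V : Type*} [DecidableEq V] (E : Set (Finset V)) (w : V) : Set (Finset V) :=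
  {e | w ∉ e ∧ insert w e ∈ E}

/-- For every `k`-subset `S` of `U`, any two vertices of `U \ S` are at distance at most two in
the link graph of `S` on `U \ S`. -/
def LinksClose {V : Type*} [DecidableEq V] (k : ℕ) (E : Set (Finset V)) (U : Finset V) : Prop :=
  ∀ S ⊆ U, S.card = k → ∀ a ∈ U \ S, ∀ b ∈ U \ S, a ≠ b →
    insert a (insert b S) ∈ E ∨
      ∃ c ∈ U, insert a (insert c S) ∈ E ∧ insert b (insert c S) ∈ E

section

variable {V : Type*} [DecidableEq V]

theorem Disperse.erasureClosed {n : ℕ} (hn : 3 ≤ n) {E : Finset (Finset V)}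
    (hcard : ∀ e ∈ E, e.card = n) (h : Disperse n E) : ErasureClosed n (E : Set (Finset V)) := by
  intro W hW a ha b hb c hc d hd hab hcd hEa hEb
  by_contra! hcon
  have inj : ∀ x ∈ W, ∀ y ∈ W, W.erase x = W.erase y → x = y := fun x hx y hy hxy => by
    by_contra hne
    exact notMem_erase x W (hxy ▸ mem_erase.2 ⟨hne, hx⟩)
  have lower : 2 ≤ (E.filter (· ⊆ W)).card := by
    rw [← card_pair (fun heq => hab (inj a ha b hb heq))]
    refine card_le_card fun e he => ?_
    rcases mem_insert.1 he with rfl | he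
    · exact mem_filter.2 ⟨hEa, erase_subset _ _⟩
    · rw [mem_singleton.1 he]
      exact mem_filter.2 ⟨hEb, erase_subset _ _⟩
  have upper : (E.filter (· ⊆ W)).card ≤ ((W.erase c).erase d).card := by
    refine (card_le_card fun e he => ?_).trans (card_image_le (f := W.erase))
    obtain ⟨heE, heW⟩ := mem_filter.1 he
    have hlt : e.card < W.card := by rw [hW, hcard e heE]; omega
    obtain ⟨x, hxW, hxe⟩ := exists_mem_notMem_of_card_lt_card hlt
    have hx : e = W.erase x := eq_of_subset_of_card_le (subset_erase.2 ⟨heW, hxe⟩)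
      (by rw [card_erase_of_mem hxW, hW, hcard e heE]; omega)
    refine mem_image.2 ⟨x, mem_erase.2 ⟨?_, mem_erase.2 ⟨?_, hxW⟩⟩, hx.symm⟩
    · rintro rfl
      exact hcon.2 (hx ▸ heE)
    · rintro rfl
      exact hcon.1 (hx ▸ heE)
  rw [card_erase_of_mem (mem_erase.2 ⟨hcd.symm, hd⟩), card_erase_of_mem hc, hW] at upper
  rcases h W hW with h | h | h | h <;> omega

theorem ErasureClosed.link {n : ℕ} {E : Set (Finset V)} (h : ErasureClosed (n + 1) E)
    (w : V) : ErasureClosed n (vertexLink E w) := by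
  intro W hW a ha b hb c hc d hd hab hcd hEa hEb
  have hw : w ∉ W := fun hw => by
    by_cases hwa : w = a
    · exact hEb.1 (mem_erase.2 ⟨hwa ▸ hab, hw⟩)
    · exact hEa.1 (mem_erase.2 ⟨hwa, hw⟩)
  have key : ∀ x ∈ W, (insert w W).erase x = insert w (W.erase x) := fun x hx =>
    erase_insert_of_ne (fun hwx => hw (hwx ▸ hx))
  have hmem : ∀ x ∈ W, ((insert w W).erase x ∈ E ↔ W.erase x ∈ vertexLink E w) :=
    fun x hx => by
      rw [key x hx]
      exact ⟨fun hx => ⟨fun hw' => hw (mem_of_mem_erase hw'), hx⟩, fun hx => hx.2⟩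
  rw [← hmem _ ha] at hEa
  rw [← hmem _ hb] at hEb
  rw [← hmem _ hc, ← hmem _ hd]
  exact h (insert w W) (by rw [card_insert_of_notMem hw, hW]) a (mem_insert_of_mem ha) b
    (mem_insert_of_mem hb) c (mem_insert_of_mem hc) d (mem_insert_of_mem hd) hab hcd hEa hEb

theorem card_of_mem_vertexLink {n : ℕ} {E : Set (Finset V)} (h : ∀ e ∈ E, e.card = n + 1)
    (w : V) : ∀ e ∈ vertexLink E w, e.card = n := by
  intro e he
  have := h _ he.2
  rw [card_insert_of_notMem he.1] at this
  omega

theorem LinksClose.link {k : ℕ} {E : Set (Finset V)} {U : Finset V}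
    (hcard : ∀ e ∈ E, e.card = k + 3) (h : LinksClose (k + 1) E U) {w : V} (hw : w ∈ U) :
    LinksClose k (vertexLink E w) (U.erase w) := by
  intro S hS hSc a ha b hb hab
  have hwS : w ∉ S := fun hh => notMem_erase w U (hS hh)
  simp only [mem_sdiff, mem_erase] at ha hb
  have h1 := h (insert w S) (insert_subset hw (hS.trans (erase_subset _ _)))
    (by rw [card_insert_of_notMem hwS, hSc]) a (by grind) b (by grind) hab
  have comm : ∀ x y : V, insert x (insert y (insert w S)) = insert w (insert x (insert y S)) := by
    intro x y; grind
  simp only [comm] at h1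
  rcases h1 with h1 | ⟨c, hc, h1, h2⟩
  · exact Or.inl ⟨by grind, h1⟩
  · have hcw : c ≠ w := by
      rintro rfl
      have h3 := hcard _ h1
      have h4 : insert c (insert a (insert c S)) = insert a (insert c S) := by grind
      rw [h4] at h3
      have := card_le_two (a := a) (b := c)
      have := card_insert_le a (insert c S)
      have := card_insert_le c S
      omega
    exact Or.inr ⟨c, by grind, ⟨by grind, h1⟩, ⟨by grind, h2⟩⟩

theorem ne_of_card_triple {a b c : V} (h : ({a, b, c} : Finset V).card = 3) :
    a ≠ b ∧ a ≠ c ∧ b ≠ c := by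
  have h1 := card_insert_le a {b, c}
  refine ⟨?_, ?_, ?_⟩ <;> rintro rfl
  · have := card_le_two (a := a) (b := c)
    rw [insert_eq_of_mem (by simp)] at h
    omega
  · have := card_le_two (a := b) (b := a)
    rw [insert_eq_of_mem (by simp)] at h
    omega
  · have := card_le_two (a := a) (b := b)
    rw [insert_eq_of_mem (s := {b}) (by simp)] at h
    omega

/-- A ternary form of the disperse condition for `3`-uniform hypergraphs. -/
theorem ErasureClosed.triples {E : Set (Finset V)} (h : ErasureClosed 3 E)
    (hcard : ∀ e ∈ E, e.card = 3) {a b c d : V} (hcd : c ≠ d)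
    (h1 : {a, b, c} ∈ E) (h2 : {a, b, d} ∈ E) : {a, c, d} ∈ E ∨ {b, c, d} ∈ E := by
  obtain ⟨hab, hac, hbc⟩ := ne_of_card_triple (hcard _ h1)
  obtain ⟨-, had, hbd⟩ := ne_of_card_triple (hcard _ h2)
  have e1 : ({a, b, c, d} : Finset V).erase d = {a, b, c} := by grind
  have e2 : ({a, b, c, d} : Finset V).erase c = {a, b, d} := by grind
  have e3 : ({a, b, c, d} : Finset V).erase b = {a, c, d} := by grind
  have e4 : ({a, b, c, d} : Finset V).erase a = {b, c, d} := by grind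
  have := h {a, b, c, d} (by grind) d (by simp) c (by simp) b (by simp) a (by simp)
    hcd.symm hab.symm
  rw [e1, e2, e3, e4] at this
  exact this h1 h2

/-- Two vertices are equal, or at distance at most two in the link graph of `s` within `U`. -/
def LinkNear {V : Type*} (H : V → V → V → Prop) (U : Finset V) (s a b : V) : Prop :=
  a = b ∨ H s a b ∨ ∃ c ∈ U, H s a c ∧ H s c b

/-- The link graphs of a disperse `3`-uniform hypergraph contain no induced path on four
vertices. -/
theorem chord_of_path {V : Type*} {H : V → V → V → Prop} (hne : ∀ a b c, H a b c → a ≠ b)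
    (hswap : ∀ a b c, H a b c → H b a c) (hrot : ∀ a b c, H a b c → H b c a)
    (hH : ∀ a b c d, c ≠ d → H a b c → H a b d → H a c d ∨ H b c d)
    {s a b c d : V} (had : a ≠ d) (h1 : H s a b) (h2 : H s b c) (h3 : H s c d) :
    H s a d ∨ H s a c ∨ H s b d := by
  by_contra! hcon
  obtain ⟨n1, n2, n3⟩ := hcon
  have hac : a ≠ c := by
    rintro rfl
    exact n1 h3
  have hbd : b ≠ d := by
    rintro rfl
    exact n1 h1
  have habc : H b a c := by
    have := hH s b a c hac
    grind
  have hbcd : H c b d := by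
    have := hH s c b d hbd
    grind
  have := hH b c a d had (by grind) (by grind)
  have := hH a b s d
  have := hH c d s a
  grind

theorem LinkNear.trans {H : V → V → V → Prop} (hne : ∀ a b c, H a b c → a ≠ b)
    (hswap : ∀ a b c, H a b c → H b a c) (hrot : ∀ a b c, H a b c → H b c a)
    (hH : ∀ a b c d, c ≠ d → H a b c → H a b d → H a c d ∨ H b c d)
    {U : Finset V} {s a b c : V} (hb : b ∈ U)
    (h1 : LinkNear H U s a b) (h2 : LinkNear H U s b c) : LinkNear H U s a c := by
  have step : ∀ a b, b ∈ U → H s a b → LinkNear H U s b c → LinkNear H U s a c := by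
    intro a b hb hab h
    rcases h with rfl | h | ⟨d, hd, hbd, hdc⟩
    · exact Or.inr (Or.inl hab)
    · exact Or.inr (Or.inr ⟨b, hb, hab, h⟩)
    · by_cases hac : a = c
      · exact Or.inl hac
      rcases chord_of_path hne hswap hrot hH hac hab hbd hdc with h | h | h
      · exact Or.inr (Or.inl h)
      · exact Or.inr (Or.inr ⟨d, hd, h, hdc⟩)
      · exact Or.inr (Or.inr ⟨b, hb, hab, h⟩)
  rcases h1 with rfl | h | ⟨d, hd, had, hdb⟩
  · exact h2
  · exact step a b hb h h2
  · exact step a d hd had (step d b hb hdb h2)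

theorem LinkNear.insert_of_triple {H : V → V → V → Prop} (hne : ∀ a b c, H a b c → a ≠ b)
    (hswap : ∀ a b c, H a b c → H b a c) (hrot : ∀ a b c, H a b c → H b c a)
    (hH : ∀ a b c d, c ≠ d → H a b c → H a b d → H a c d ∨ H b c d)
    {U : Finset V} (h : ∀ s ∈ U, ∀ a ∈ U, ∀ b ∈ U, a ≠ s → b ≠ s → LinkNear H U s a b)
    {v x y : V} (hv : v ∉ U) (hx : x ∈ U) (hy : y ∈ U) (hxy : H x y v) :
    ∀ s ∈ insert v U, ∀ a ∈ insert v U, ∀ b ∈ insert v U, a ≠ s → b ≠ s →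
      LinkNear H (insert v U) s a b := by
  have hsymm : ∀ W s a b, LinkNear H W s a b → LinkNear H W s b a := by
    rintro W s a b (rfl | h | ⟨c, hc, h1, h2⟩)
    · exact Or.inl rfl
    · exact Or.inr (Or.inl (by grind))
    · exact Or.inr (Or.inr ⟨c, hc, by grind, by grind⟩)
  have hmono : ∀ s a b, LinkNear H U s a b → LinkNear H (insert v U) s a b := by
    rintro s a b (h | h | ⟨c, hc, h1, h2⟩)
    · exact Or.inl h
    · exact Or.inr (Or.inl h)
    · exact Or.inr (Or.inr ⟨c, mem_insert_of_mem hc, h1, h2⟩)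
  have hextend : ∀ s ∈ U, ∀ u ∈ U, H s u v → ∀ a ∈ U, a ≠ s →
      LinkNear H (insert v U) s a v := by
    intro s hs u hu hsuv a ha has
    exact (hmono s a u (h s hs a ha u hu has (hne _ _ _ hsuv).symm)).trans hne hswap hrot hH
      (mem_insert_of_mem hu) (Or.inr (Or.inl hsuv))
  have hreach : ∀ z ∈ U, z ≠ x → H x z v ∨ ∃ c ∈ U, H x z c ∧ H x c v ∧ H z c v := by
    intro z hz hzx
    rcases hextend x hx y hy hxy z hz hzx with rfl | h | ⟨c, hc, h1, h2⟩
    · exact absurd hz hv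
    · exact Or.inl h
    · have hcv : c ≠ v := hne _ _ _ (hrot _ _ _ h2)
      have hzv : z ≠ v := fun hh => hv (hh ▸ hz)
      rcases hH x c z v hzv (by grind) h2 with h3 | h3
      · exact Or.inl h3
      · exact Or.inr ⟨c, mem_of_mem_insert_of_ne hc hcv, h1, h2, by grind⟩
  have hold : ∀ s ∈ U, ∀ a ∈ U, a ≠ s → LinkNear H (insert v U) s a v := by
    intro s hs a ha has
    by_cases hsx : s = x
    · exact hextend s hs y hy (hsx ▸ hxy) a ha has
    rcases hreach s hs hsx with h1 | ⟨c, hc, -, -, h1⟩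
    · exact hextend s hs x hx (hswap _ _ _ h1) a ha has
    · exact hextend s hs c hc h1 a ha has
  have hnew : ∀ a ∈ U, LinkNear H (insert v U) v a x := by
    intro a ha
    by_cases hax : a = x
    · exact Or.inl hax
    rcases hreach a ha hax with h1 | ⟨c, hc, -, h1, h2⟩
    · exact Or.inr (Or.inl (by grind))
    · exact Or.inr (Or.inr ⟨c, mem_insert_of_mem hc, by grind, by grind⟩)
  intro s hs a ha b hb has hbs
  rcases mem_insert.1 hs with rfl | hsU
  · exact (hnew a (mem_of_mem_insert_of_ne ha has)).trans hne hswap hrot hH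
      (mem_insert_of_mem hx) (hsymm _ _ _ _ (hnew b (mem_of_mem_insert_of_ne hb hbs)))
  rcases mem_insert.1 ha with rfl | haU <;> rcases mem_insert.1 hb with rfl | hbU
  · exact Or.inl rfl
  · exact hsymm _ _ _ _ (hold s hsU b hbU hbs)
  · exact hold s hsU a haU has
  · exact hmono s a b (h s hsU a haU b hbU has hbs)

theorem linksClose_one_iff {E : Set (Finset V)} {U : Finset V} :
    LinksClose 1 E U ↔ ∀ s ∈ U, ∀ a ∈ U, ∀ b ∈ U, a ≠ s → b ≠ s →
      LinkNear (fun a b c => ({a, b, c} : Finset V) ∈ E) U s a b := by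
  have hrot : ∀ {s a b : V}, ({s, a, b} : Finset V) ∈ E ↔ insert a (insert b {s}) ∈ E := by
    intro s a b
    rw [show ({s, a, b} : Finset V) = insert a (insert b {s}) by grind]
  have hrev : ∀ {s a b : V}, ({s, a, b} : Finset V) ∈ E ↔ insert b (insert a {s}) ∈ E := by
    intro s a b
    rw [show ({s, a, b} : Finset V) = insert b (insert a {s}) by grind]
  constructor
  · intro h s hs a ha b hb has hbs
    by_cases hab : a = b
    · exact Or.inl hab
    rcases h {s} (by simpa using hs) (by simp) a (by simp [ha, has]) b (by simp [hb, hbs]) hab with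
      h1 | ⟨c, hc, h1, h2⟩
    · exact Or.inr (Or.inl (hrot.2 h1))
    · exact Or.inr (Or.inr ⟨c, hc, hrot.2 h1, hrev.2 h2⟩)
  · intro h S hS hSc a ha b hb hab
    obtain ⟨s, rfl⟩ := card_eq_one.1 hSc
    simp only [mem_sdiff, mem_singleton, singleton_subset_iff] at ha hb hS
    rcases h s hS a ha.1 b hb.1 ha.2 hb.2 with h1 | h1 | ⟨c, hc, h1, h2⟩
    · exact absurd h1 hab
    · exact Or.inl (hrot.1 h1)
    · exact Or.inr ⟨c, hc, hrot.1 h1, hrev.1 h2⟩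

theorem LinksClose.insert_of_pair {E : Set (Finset V)} (hE : ErasureClosed 3 E)
    (hcard : ∀ e ∈ E, e.card = 3) {U : Finset V} (h : LinksClose 1 E U) {v x y : V} (hv : v ∉ U)
    (hx : x ∈ U) (hy : y ∈ U) (hxy : {x, y, v} ∈ E) : LinksClose 1 E (insert v U) := by
  rw [linksClose_one_iff] at h ⊢
  refine LinkNear.insert_of_triple (fun a b c habc => (ne_of_card_triple (hcard _ habc)).1)
    (fun a b c habc => ?_) (fun a b c habc => ?_)
    (fun a b c d hcd => hE.triples hcard hcd) h hv hx hy hxy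
  · have : ({b, a, c} : Finset V) = {a, b, c} := insert_comm b a {c}
    rwa [this]
  · have : ({b, c, a} : Finset V) = {a, b, c} := by grind
    rwa [this]

theorem LinksClose.insert_of_edge {k : ℕ} : ∀ {E : Set (Finset V)}, ErasureClosed (k + 3) E →
    (∀ e ∈ E, e.card = k + 3) → ∀ {U : Finset V}, LinksClose (k + 1) E U → ∀ {v : V}, v ∉ U →
    ∀ {A : Finset V}, A ⊆ U → insert v A ∈ E → LinksClose (k + 1) E (insert v U) := by
  induction k with
  | zero =>
    intro E hE hcard U h v hv A hA hAE
    have hA2 : A.card = 2 := by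
      have := hcard _ hAE
      rw [card_insert_of_notMem (fun hh => hv (hA hh))] at this
      omega
    obtain ⟨x, y, -, rfl⟩ := card_eq_two.1 hA2
    refine h.insert_of_pair hE hcard hv (hA (by simp)) (hA (by simp)) (x := x) (y := y) ?_
    convert hAE using 1
    grind
  | succ k ih =>
    intro E hE hcard U h v hv
    have hlink : ∀ A ⊆ U, insert v A ∈ E → ∀ w ∈ A,
        LinksClose (k + 1) (vertexLink E w) ((insert v U).erase w) := by
      intro A hA hAE w hw
      have hvw : v ≠ w := fun hh => hv (hh ▸ hA hw)
      rw [erase_insert_of_ne hvw]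
      refine ih (hE.link w) (card_of_mem_vertexLink hcard w)
        (h.link hcard (hA hw)) (fun hh => hv (mem_of_mem_erase hh))
        (erase_subset_erase w hA) ⟨by grind, ?_⟩
      rw [insert_comm, insert_erase hw]
      exact hAE
    intro A hA hAE S hS hSc
    obtain ⟨z, hzS, hzv⟩ := exists_mem_ne (by omega : 1 < S.card) v
    obtain ⟨B, hB, hBE, hzB⟩ : ∃ B ⊆ U, insert v B ∈ E ∧ z ∈ B := by
      by_cases hzA : z ∈ A
      · exact ⟨A, hA, hAE, hzA⟩
      have hAc : A.card = k + 3 := by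
        have := hcard _ hAE
        rw [card_insert_of_notMem (fun hh => hv (hA hh))] at this
        omega
      obtain ⟨w, hw⟩ : A.Nonempty := card_pos.1 (by omega)
      obtain ⟨R, hR, hRc⟩ := exists_subset_card_eq (s := A.erase w) (n := k)
        (by rw [card_erase_of_mem hw]; omega)
      obtain ⟨b, hb, hbR⟩ := exists_mem_notMem_of_card_lt_card (s := R) (t := A.erase w)
        (by rw [card_erase_of_mem hw]; omega)
      have hvA : v ∉ A := fun hh => hv (hA hh)
      have hsub : ∀ r ∈ R, r ∈ A ∧ r ≠ w := fun r hr => by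
        have := hR hr
        grind
      have hvR : v ∉ R := fun hh => hvA (hsub v hh).1
      have hzU : z ∈ U := by have := hS hzS; grind
      have build : ∀ c ∈ insert v U, insert z (insert c (insert v R)) ∈ vertexLink E w →
          ∃ B ⊆ U, insert v B ∈ E ∧ z ∈ B := by
        intro c hc hcE
        refine ⟨(insert w (insert z (insert c R))).erase v, ?_, ?_, by grind⟩
        · intro t ht
          simp only [mem_erase, mem_insert] at ht
          rcases ht with ⟨htv, rfl | rfl | rfl | htR⟩
          · exact hA hw
          · exact hzU
          · exact mem_of_mem_insert_of_ne hc htv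
          · exact hA (hsub t htR).1
        · convert hcE.2 using 1
          have := hA hw
          grind
      have hclose := hlink A hA hAE w hw (insert v R)
        (by
          intro t ht
          have := hsub t
          have := @hA t
          have := hA hw
          grind)
        (by rw [card_insert_of_notMem hvR, hRc]) z (by have := hsub z; grind) b
        (by have := @hA b; grind) (by grind)
      rcases hclose with h1 | ⟨c, hc, h1, -⟩
      · exact build b (by have := @hA b; grind) h1
      · exact build c (mem_of_mem_erase hc) h1
    intro a ha b hb hab
    have comm : ∀ x y : V, insert z (insert x (insert y (S.erase z))) = insert x (insert y S) := by
      intro x y; grind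
    rcases hlink B hB hBE z hzB (S.erase z) (erase_subset_erase z hS)
      (by rw [card_erase_of_mem hzS]; omega) a (by grind) b (by grind) hab with
      h1 | ⟨c, hc, h1, h2⟩
    · exact Or.inl (comm a b ▸ h1.2)
    · exact Or.inr ⟨c, mem_of_mem_erase hc, comm a c ▸ h1.2, comm b c ▸ h2.2⟩

theorem TightConn.trans {n : ℕ} {E : Finset (Finset V)} {A B C : Finset V} (hB : B.card = n - 1)
    (h1 : TightConn n E A B) (h2 : TightConn n E B C) : TightConn n E A C := by
  obtain ⟨es, hne, hes, hch, hA, hB1⟩ := h1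
  obtain ⟨fs, hnf, hfs, hcf, hB2, hC⟩ := h2
  refine ⟨es ++ fs, by simp [hne], ?_, ?_, ?_, ?_⟩
  · intro e he
    rcases List.mem_append.1 he with he | he
    · exact hes e he
    · exact hfs e he
  · refine List.isChain_append.2 ⟨hch, hcf, ?_⟩
    intro a ha b hb
    rw [List.getLast?_eq_some_getLast hne, Option.mem_some] at ha
    rw [List.head?_eq_some_head hnf, Option.mem_some] at hb
    subst ha hb
    rw [← hB]
    exact card_le_card (subset_inter hB1 hB2)
  · rwa [List.head_append_of_ne_nil hne]
  · rwa [List.getLast_append_of_ne_nil _ hnf]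

theorem TightConn.of_mem {n : ℕ} {E : Finset (Finset V)} {A B e : Finset V} (he : e ∈ E)
    (hA : A ⊆ e) (hB : B ⊆ e) : TightConn n E A B :=
  ⟨[e], by simp, by simpa using he, List.isChain_singleton _, hA, hB⟩

theorem LinksClose.tightConn {k : ℕ} {E : Finset (Finset V)} {U : Finset V}
    (h : LinksClose (k + 1) (E : Set (Finset V)) U) (hcard : ∀ e ∈ E, e.card = k + 3) (m : ℕ) :
    ∀ {A B : Finset V}, A ⊆ U → B ⊆ U → A.card = k + 2 → B.card = k + 2 → (B \ A).card = m →
      B = A ∨ TightConn (k + 3) E A B := by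
  induction m with
  | zero =>
    intro A B _ _ hAc hBc hm
    exact Or.inl (eq_of_subset_of_card_le (sdiff_eq_empty_iff_subset.1 (card_eq_zero.1 hm))
      (by omega))
  | succ m ih =>
    intro A B hA hB hAc hBc hm
    obtain ⟨b, hb⟩ : (B \ A).Nonempty := card_pos.1 (by omega)
    obtain ⟨a, ha⟩ : (A \ B).Nonempty := card_pos.1 (by
      rw [← card_sdiff_comm (hBc.trans hAc.symm)]; omega)
    rw [mem_sdiff] at ha hb
    have hab : a ≠ b := fun hh => hb.2 (hh ▸ ha.1)
    have hac : (A.erase a).card = k + 1 := by rw [card_erase_of_mem ha.1]; omega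
    have hbA : b ∉ A.erase a := fun hh => hb.2 (mem_of_mem_erase hh)
    have hA' : (insert b (A.erase a)).card = k + 2 := by
      rw [card_insert_of_notMem hbA, hac]
    have hstep : TightConn (k + 3) E A (insert b (A.erase a)) := by
      have hsubA : ∀ c, A ⊆ insert a (insert c (A.erase a)) := fun c t ht => by grind
      rcases h (A.erase a) ((erase_subset _ _).trans hA) hac a
        (mem_sdiff.2 ⟨hA ha.1, notMem_erase a A⟩) b (mem_sdiff.2 ⟨hB hb.1, hbA⟩) hab with
        h1 | ⟨c, -, h1, h2⟩
      · exact .of_mem h1 (hsubA b) (subset_insert _ _)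
      · have hcc : (insert c (A.erase a)).card = k + 3 - 1 := by
          have := hcard _ h1
          have := card_insert_le a (insert c (A.erase a))
          have := card_insert_le c (A.erase a)
          omega
        exact (TightConn.of_mem h1 (hsubA c) (subset_insert _ _)).trans hcc
          (.of_mem h2 (subset_insert _ _) (insert_subset_insert _ (subset_insert _ _)))
    have hm' : (B \ insert b (A.erase a)).card = m := by
      have : B \ insert b (A.erase a) = (B \ A).erase b := by grind
      rw [this, card_erase_of_mem (mem_sdiff.2 hb), hm]
      rfl
    rcases ih (insert_subset (hB hb.1) ((erase_subset _ _).trans hA)) hB hA' hBc hm' with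
      heq | hconn
    · exact Or.inr (heq ▸ hstep)
    · exact Or.inr (hstep.trans hA' hconn)

/-- A tight walk starting in a set that absorbs every edge meeting it in all but one vertex
never leaves that set. -/
theorem TightConn.subset_of_absorbing {n : ℕ} {E : Finset (Finset V)} {U A B : Finset V}
    (hU : ∀ e ∈ E, n - 1 ≤ (e ∩ U).card → e ⊆ U) (hAU : A ⊆ U) (hA : A.card = n - 1)
    (h : TightConn n E A B) : B ⊆ U := by
  obtain ⟨es, hne, hes, hch, hhead, hlast⟩ := h
  have main : ∀ (es : List (Finset V)) (hne : es ≠ []), (∀ e ∈ es, e ∈ E) →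
      es.IsChain (fun a b => n - 1 ≤ (a ∩ b).card) → es.head hne ⊆ U → es.getLast hne ⊆ U := by
    intro es
    induction es with
    | nil => intro hne; exact absurd rfl hne
    | cons e fs ih =>
      intro hne hes hch hhead
      cases fs with
      | nil => simpa using hhead
      | cons f fs =>
        rw [List.isChain_cons_cons] at hch
        rw [List.getLast_cons (by simp)]
        refine ih (by simp) (fun g hg => hes g (List.mem_cons_of_mem _ hg)) hch.2 ?_
        refine hU f (hes f (by simp)) (hch.1.trans (card_le_card fun t ht => ?_))
        rw [mem_inter] at ht ⊢
        exact ⟨ht.2, hhead ht.1⟩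
  refine hlast.trans (main es hne hes hch (hU _ (hes _ (List.head_mem hne)) ?_))
  rw [← hA]
  exact card_le_card (subset_inter hhead hAU)

end

/-- every tight component is the family of all `(ℓ-1)`-subsets of
some vertex set `U`. -/
theorem tight_components_are_cliques {V : Type*} [DecidableEq V] (ℓ : ℕ) (hℓ : 3 ≤ ℓ)
    (E : Finset (Finset V)) (hunif : ∀ e ∈ E, e.card = ℓ) (hdisp : Disperse ℓ E) :
    ∀ A : Finset V, A.card = ℓ - 1 →
      ∃ U : Finset V, ∀ B : Finset V, B.card = ℓ - 1 →
        ((B = A ∨ TightConn ℓ E A B) ↔ B ⊆ U) := by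
  intro A hA
  have hclosed := hdisp.erasureClosed hℓ hunif
  obtain ⟨k, rfl⟩ : ∃ k, ℓ = k + 3 := ⟨ℓ - 3, by omega⟩
  classical
  let F := ((A ∪ E.sup id).powerset).filter
    (fun U => A ⊆ U ∧ LinksClose (k + 1) (E : Set (Finset V)) U)
  have hAF : A ∈ F := by
    refine mem_filter.2 ⟨mem_powerset.2 subset_union_left, Subset.rfl, ?_⟩
    intro S hS hSc a ha b hb hab
    have h1 := card_sdiff_add_card_eq_card hS
    exact absurd (card_le_one.1 (by omega : (A \ S).card ≤ 1) a ha b hb) hab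
  obtain ⟨U, hUF, hmax⟩ := exists_max_image F card ⟨A, hAF⟩
  obtain ⟨hUs, hAU, hU⟩ := mem_filter.1 hUF
  have habsorb : ∀ e ∈ E, k + 3 - 1 ≤ (e ∩ U).card → e ⊆ U := by
    intro e he hecard
    by_contra hsub
    obtain ⟨v, hve, hvU⟩ := not_subset.1 hsub
    have hins : insert v (e ∩ U) = e := by
      refine eq_of_subset_of_card_le (insert_subset hve inter_subset_left) ?_
      rw [card_insert_of_notMem (fun hh => hvU (mem_inter.1 hh).2), hunif e he]
      omega
    have hnew := hU.insert_of_edge hclosed hunif hvU (A := e ∩ U) inter_subset_right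
      (by rw [hins]; exact he)
    have hmem : insert v U ∈ F := by
      refine mem_filter.2 ⟨mem_powerset.2 (insert_subset ?_ (mem_powerset.1 hUs)),
        hAU.trans (subset_insert _ _), hnew⟩
      exact mem_union_right _ (mem_sup.2 ⟨e, he, hve⟩)
    have := hmax _ hmem
    rw [card_insert_of_notMem hvU] at this
    omega
  refine ⟨U, fun B hB => ⟨?_, fun hBU => hU.tightConn hunif _ hAU hBU hA hB rfl⟩⟩
  rintro (rfl | h)
  · exact hAU
  · exact h.subset_of_absorbing habsorb hAU hA
end

section
/- For every ℓ ≥ 3 there is a constant c > 0 such that every disperse ℓ-uniform hypergraph G on n vertices satisfies max(α(G), ω(G)) ≥ c·n^{1/(3ℓ−1)}. -/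
open Finset

/-- Two subsets of `S` of size `|S| - 1` with the same colour force that colour on `S`, as soon
as `S` has more than `ℓ` elements. -/
def IsMajorityColoring {V : Type*} [DecidableEq V] (ℓ : ℕ) (c : Finset V → Prop) : Prop :=
  ∀ S : Finset V, ℓ < S.card → ∀ x ∈ S, ∀ y ∈ S, x ≠ y →
    (c (S.erase x) → c (S.erase y) → c S) ∧ (¬ c (S.erase x) → ¬ c (S.erase y) → ¬ c S)

/-- The iterated majority colouring: a set of size `ℓ + k + 1` is coloured if at least two of its
subsets of size `ℓ + k` are. -/
def majorityExtension {V : Type*} [DecidableEq V] (E : Finset (Finset V)) : ℕ → Finset V → Prop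
  | 0, S => S ∈ E
  | k + 1, S => ∃ x ∈ S, ∃ y ∈ S, x ≠ y ∧
      majorityExtension E k (S.erase x) ∧ majorityExtension E k (S.erase y)

/-- After excluding at most `L * |W| ^ 2` many `ℓ`-sets, every subset of `W` contains an
uncoloured and a coloured homogeneous set whose sizes multiply to at least its own size. -/
def AlmostCograph {V : Type*} (ℓ : ℕ) (c : Finset V → Prop) (L : ℕ) (W : Finset V) : Prop :=
  ∃ F : Finset (Finset V), (∀ f ∈ F, f ⊆ W ∧ f.card = ℓ) ∧ F.card ≤ L * W.card ^ 2 ∧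
    ∀ U ⊆ W, (∀ f ∈ F, ¬ f ⊆ U) → ∃ A ⊆ U, ∃ B ⊆ U, (∀ e ⊆ A, e.card = ℓ → ¬ c e) ∧
      (∀ e ⊆ B, e.card = ℓ → c e) ∧ U.card ≤ A.card * B.card

section AlmostCograph

variable {V : Type*} {ℓ : ℕ} {c : Finset V → Prop}

lemma AlmostCograph.compl {L : ℕ} {W : Finset V} (h : AlmostCograph ℓ c L W) :
    AlmostCograph ℓ (fun S => ¬ c S) L W := by
  obtain ⟨F, hF, hFc, hU⟩ := h
  refine ⟨F, hF, hFc, fun U hUW hUF => ?_⟩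
  obtain ⟨A, hA, B, hB, hAc, hBc, hAB⟩ := hU U hUW hUF
  exact ⟨B, hB, A, hA, fun e he hel => not_not.2 (hBc e he hel), hAc, by rwa [mul_comm]⟩

lemma almostCograph_of_forall_not (hℓ : 2 ≤ ℓ) {L : ℕ} {W : Finset V}
    (h : ∀ e ⊆ W, e.card = ℓ → ¬ c e) : AlmostCograph ℓ c L W := by
  refine ⟨∅, by simp, by simp, fun U hUW _ => ?_⟩
  rcases U.eq_empty_or_nonempty with rfl | ⟨x, hx⟩
  · exact ⟨∅, subset_rfl, ∅, subset_rfl, fun e he => h e (he.trans hUW), fun e he hel => by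
      rw [subset_empty.1 he, card_empty] at hel; omega, by simp⟩
  · refine ⟨U, subset_rfl, {x}, singleton_subset_iff.2 hx, fun e he => h e (he.trans hUW),
      fun e he hel => ?_, by simp⟩
    have := card_le_card he
    rw [card_singleton] at this
    omega

end AlmostCograph

section Coloring

variable {V : Type*} [DecidableEq V] {ℓ : ℕ}

lemma Disperse.not_mixed {E : Finset (Finset V)} (hE : ∀ e ∈ E, e.card = ℓ)
    (hD : Disperse ℓ E) {S : Finset V} (hS : S.card = ℓ + 1) {x y z w : V}
    (hx : x ∈ S) (hz : z ∈ S) (hw : w ∈ S) (hxy : x ≠ y) (hzw : z ≠ w)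
    (hxE : S.erase x ∈ E) (hyE : S.erase y ∈ E) (hzE : S.erase z ∉ E) (hwE : S.erase w ∉ E) :
    False := by
  have h1 : 2 ≤ (E.filter (· ⊆ S)).card := by
    have hne : S.erase x ≠ S.erase y := fun h => by
      have : x ∉ S.erase y := h ▸ notMem_erase x S
      exact this (mem_erase.2 ⟨hxy, hx⟩)
    rw [← card_pair hne]
    refine card_le_card ?_
    intro e he
    simp only [mem_insert, mem_singleton] at he
    rcases he with rfl | rfl
    · exact mem_filter.2 ⟨hxE, erase_subset _ _⟩
    · exact mem_filter.2 ⟨hyE, erase_subset _ _⟩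
  have h2 : (E.filter (· ⊆ S)).card ≤ ((S.erase z).erase w).card := by
    refine (card_le_card ?_).trans (card_image_le (f := fun a => S.erase a))
    intro e he
    obtain ⟨heE, heS⟩ := mem_filter.1 he
    have hc : (S \ e).card = 1 := by
      rw [card_sdiff_of_subset heS, hS, hE e heE]; omega
    obtain ⟨a, ha⟩ := card_eq_one.1 hc
    have hea : S.erase a = e := by
      rw [← sdiff_singleton_eq_erase, ← ha, Finset.sdiff_sdiff_eq_self heS]
    have haS : a ∈ S := (mem_sdiff.1 (ha ▸ mem_singleton_self a)).1
    refine mem_image.2 ⟨a, mem_erase.2 ⟨?_, mem_erase.2 ⟨?_, haS⟩⟩, hea⟩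
    · rintro rfl; exact hwE (hea ▸ heE)
    · rintro rfl; exact hzE (hea ▸ heE)
  rw [card_erase_of_mem (mem_erase.2 ⟨hzw.symm, hw⟩), card_erase_of_mem hz, hS] at h2
  have := hD S hS
  omega

lemma majorityExtension_not_mixed (hℓ : 3 ≤ ℓ) {E : Finset (Finset V)}
    (hE : ∀ e ∈ E, e.card = ℓ) (hD : Disperse ℓ E) (k : ℕ) :
    ∀ S : Finset V, S.card = ℓ + k + 1 → ∀ x ∈ S, ∀ y ∈ S, ∀ z ∈ S, ∀ w ∈ S, x ≠ y → z ≠ w →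
      majorityExtension E k (S.erase x) → majorityExtension E k (S.erase y) →
      ¬ majorityExtension E k (S.erase z) → ¬ majorityExtension E k (S.erase w) → False := by
  induction k with
  | zero =>
    intro S hS x hx y hy z hz w hw hxy hzw h1 h2 h3 h4
    exact hD.not_mixed hE hS hx hz hw hxy hzw h1 h2 h3 h4
  | succ k ih =>
    intro S hS x hx y hy z hz w hw hxy hzw h1 h2 h3 h4
    set A : V → V → Prop := fun a b => majorityExtension E k ((S.erase a).erase b) with hA
    have symm : ∀ a b, A a b → A b a := fun a b h => by
      simpa only [hA, erase_right_comm] using h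
    have blue : ∀ a ∈ S, majorityExtension E (k + 1) (S.erase a) →
        ∀ b ∈ S, ∀ d ∈ S, b ≠ a → d ≠ a → b ≠ d → A a b ∨ A a d := by
      intro a ha ⟨p, hp, q, hq, hpq, hp', hq'⟩ b hb d hd hba hda hbd
      by_contra! hcon
      exact ih (S.erase a) (by rw [card_erase_of_mem ha]; omega) p hp q hq b
        (mem_erase.2 ⟨hba, hb⟩) d (mem_erase.2 ⟨hda, hd⟩) hpq hbd hp' hq' hcon.1 hcon.2
    have red : ∀ a ∈ S, ¬ majorityExtension E (k + 1) (S.erase a) →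
        ∀ b ∈ S, ∀ d ∈ S, b ≠ a → d ≠ a → b ≠ d → ¬ A b a ∨ ¬ A d a := by
      intro a ha h b hb d hd hba hda hbd
      by_contra! hcon
      exact h ⟨b, mem_erase.2 ⟨hba, hb⟩, d, mem_erase.2 ⟨hda, hd⟩, hbd,
        symm _ _ hcon.1, symm _ _ hcon.2⟩
    have hxz : x ≠ z := by rintro rfl; exact h3 h1
    have hxw : x ≠ w := by rintro rfl; exact h4 h1
    have hyz : y ≠ z := by rintro rfl; exact h3 h2
    have hyw : y ≠ w := by rintro rfl; exact h4 h2
    obtain ⟨u, hu, hu'⟩ : ∃ u ∈ S, u ∉ ({x, y, z, w} : Finset V) := by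
      refine exists_mem_notMem_of_card_lt_card ?_
      have : ({x, y, z, w} : Finset V).card ≤ 4 := card_le_four
      omega
    simp only [mem_insert, mem_singleton, not_or] at hu'
    obtain ⟨hux, huy, huz, huw⟩ := hu'
    have hbx := blue x hx h1 z hz w hw hxz.symm hxw.symm hzw
    have hby := blue y hy h2 z hz w hw hyz.symm hyw.symm hzw
    have hrz := red z hz h3 x hx y hy hxz hyz hxy
    have hrw := red w hw h4 x hx y hy hxw hyw hxy
    by_cases hub : majorityExtension E (k + 1) (S.erase u)
    · have hbu := blue u hu hub z hz w hw (Ne.symm huz) (Ne.symm huw) hzw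
      have r1 := red z hz h3 x hx u hu hxz huz (Ne.symm hux)
      have r2 := red z hz h3 y hy u hu hyz huz (Ne.symm huy)
      have r3 := red w hw h4 x hx u hu hxw huw (Ne.symm hux)
      have r4 := red w hw h4 y hy u hu hyw huw (Ne.symm huy)
      clear_value A
      clear blue red symm
      grind
    · have hru := red u hu hub x hx y hy (Ne.symm hux) (Ne.symm huy) hxy
      have r1 := blue x hx h1 z hz u hu hxz.symm hux (Ne.symm huz)
      have r2 := blue x hx h1 w hw u hu hxw.symm hux (Ne.symm huw)
      have r3 := blue y hy h2 z hz u hu hyz.symm huy (Ne.symm huz)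
      have r4 := blue y hy h2 w hw u hu hyw.symm huy (Ne.symm huw)
      clear_value A
      clear blue red symm
      grind

lemma Disperse.exists_isMajorityColoring (hℓ : 3 ≤ ℓ) {E : Finset (Finset V)}
    (hE : ∀ e ∈ E, e.card = ℓ) (hD : Disperse ℓ E) :
    ∃ c : Finset V → Prop, IsMajorityColoring ℓ c ∧ ∀ e, e.card = ℓ → (c e ↔ e ∈ E) := by
  refine ⟨fun S => majorityExtension E (S.card - ℓ) S, ?_, ?_⟩
  · intro S hS x hx y hy hxy
    obtain ⟨k, hk⟩ : ∃ k, S.card = ℓ + k + 1 := ⟨S.card - ℓ - 1, by omega⟩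
    have h1 : S.card - ℓ = k + 1 := by omega
    have h2 : ∀ a ∈ S, (S.erase a).card - ℓ = k := fun a ha => by
      rw [card_erase_of_mem ha]; omega
    simp only [h1, h2 x hx, h2 y hy]
    refine ⟨fun hcx hcy => ⟨x, hx, y, hy, hxy, hcx, hcy⟩, ?_⟩
    rintro hcx hcy ⟨p, hp, q, hq, hpq, hcp, hcq⟩
    exact majorityExtension_not_mixed hℓ hE hD k S hk p hp q hq x hx y hy hpq hxy hcp hcq hcx hcy
  · intro e he
    simp [he, majorityExtension]

variable {c : Finset V → Prop}

lemma IsMajorityColoring.compl (hc : IsMajorityColoring ℓ c) :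
    IsMajorityColoring ℓ (fun S => ¬ c S) := fun S hS x hx y hy hxy =>
  ⟨(hc S hS x hx y hy hxy).2, fun h1 h2 => not_not.2
    ((hc S hS x hx y hy hxy).1 (not_not.1 h1) (not_not.1 h2))⟩

/-- Coloured sets are closed under unions of sets sharing at least `ℓ - 1` elements. -/
lemma IsMajorityColoring.union (hc : IsMajorityColoring ℓ c) {S T : Finset V}
    (hS : c S) (hT : c T) (hST : ℓ ≤ (S ∩ T).card + 1) : c (S ∪ T) := by
  induction hn : S.card + T.card using Nat.strong_induction_on generalizing S T with
  | _ n ih =>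
  have key : ∀ S T : Finset V, c S → c T → ℓ ≤ (S ∩ T).card + 1 → S.card + T.card = n →
      (S \ T).Nonempty → ∃ x ∈ S \ T, c ((S ∪ T).erase x) := by
    intro S T hS hT hST hn hne
    by_cases h1 : (S \ T).card = 1
    · obtain ⟨x, hx⟩ := card_eq_one.1 h1
      refine ⟨x, by simp [hx], ?_⟩
      rwa [← sdiff_singleton_eq_erase, ← hx, show (S ∪ T) \ (S \ T) = T by
        ext a; simp only [mem_sdiff, mem_union]; tauto]
    · obtain ⟨x, hx, y, hy, hxy⟩ := one_lt_card.1
        (show 1 < (S \ T).card by have := hne.card_pos; omega)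
      have hcard := card_sdiff_add_card_inter S T
      have hpos := hne.card_pos
      obtain ⟨z, hz, hcz⟩ : ∃ z ∈ S \ T, c (S.erase z) := by
        by_contra! hcon
        exact (hc S (by omega) x (mem_sdiff.1 hx).1 y (mem_sdiff.1 hy).1 hxy).2
          (hcon x hx) (hcon y hy) hS
      obtain ⟨hzS, hzT⟩ := mem_sdiff.1 hz
      refine ⟨z, hz, ?_⟩
      have hU : (S ∪ T).erase z = S.erase z ∪ T := by
        rw [erase_union_distrib, erase_eq_of_notMem hzT]
      have hI : S.erase z ∩ T = S ∩ T := by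
        ext a; simp only [mem_inter, mem_erase]; grind
      rw [hU]
      refine ih _ ?_ hcz hT (by rwa [hI]) rfl
      rw [← hn, card_erase_of_mem hzS]
      have := card_pos.2 ⟨z, hzS⟩
      omega
  rcases (S \ T).eq_empty_or_nonempty with h | h
  · rwa [union_eq_right.2 (sdiff_eq_empty_iff_subset.1 h)]
  rcases (T \ S).eq_empty_or_nonempty with h' | h'
  · rwa [union_eq_left.2 (sdiff_eq_empty_iff_subset.1 h')]
  obtain ⟨x, hx, hcx⟩ := key S T hS hT hST hn h
  obtain ⟨y, hy, hcy⟩ := key T S hT hS (by rwa [inter_comm]) (by omega) h'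
  rw [union_comm] at hcy
  rw [mem_sdiff] at hx hy
  refine (hc (S ∪ T) ?_ x (by simp [hx.1]) y (by simp [hy.1]) ?_).1 hcx hcy
  · have h1 := card_union_add_card_inter S T
    have h2 := card_sdiff_add_card_inter S T
    have h3 := card_sdiff_add_card_inter T S
    rw [inter_comm] at h3
    have h4 := h.card_pos
    have h5 := h'.card_pos
    omega
  · rintro rfl; exact hx.2 hy.1

lemma IsMajorityColoring.union_of_forall_insert (hc : IsMajorityColoring ℓ c) {f Y : Finset V}
    (hf : ℓ ≤ f.card + 1) (hY : Y.Nonempty) (h : ∀ y ∈ Y, c (insert y f)) : c (f ∪ Y) := by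
  induction hY using Finset.Nonempty.cons_induction with
  | singleton a => simpa [union_comm] using h a (by simp)
  | cons a s ha hs ih =>
    have h1 := ih fun y hy => h y (by simp [hy])
    have h2 := hc.union (h a (by simp)) h1
      (hf.trans (Nat.succ_le_succ (card_le_card fun x hx => by simp [hx])))
    convert h2 using 1
    ext x
    simp only [mem_union, mem_cons, mem_insert]
    tauto

/-- If `F` consists of coloured `ℓ`-sets and every coloured set in `V` has at most `h` elements,
then `F` has at most `|V| ^ (ℓ - 1) * h` elements. -/
lemma IsMajorityColoring.card_le (hc : IsMajorityColoring ℓ c) (hℓ : 1 ≤ ℓ) {W : Finset V} {h : ℕ}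
    (hmax : ∀ T ⊆ W, ℓ ≤ T.card → c T → T.card ≤ h) {F : Finset (Finset V)}
    (hF : ∀ e ∈ F, e ⊆ W ∧ e.card = ℓ ∧ c e) : F.card ≤ W.card ^ (ℓ - 1) * h := by
  classical
  let Y : Finset V → Finset V := fun f => W.filter fun y => y ∉ f ∧ c (insert y f)
  have hsub : F ⊆ (powersetCard (ℓ - 1) W).biUnion fun f => (Y f).image fun y => insert y f := by
    intro e he
    obtain ⟨heW, hel, hce⟩ := hF e he
    obtain ⟨y, hy⟩ := card_pos.1 (show 0 < e.card by omega)
    refine mem_biUnion.2 ⟨e.erase y, mem_powersetCard.2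
      ⟨(erase_subset _ _).trans heW, by rw [card_erase_of_mem hy, hel]⟩, ?_⟩
    refine mem_image.2 ⟨y, mem_filter.2 ⟨heW hy, notMem_erase _ _, ?_⟩, insert_erase hy⟩
    rwa [insert_erase hy]
  refine (card_le_card hsub).trans ((card_biUnion_le_card_mul _ _ h ?_).trans ?_)
  · intro f hf
    obtain ⟨hfW, hfl⟩ := mem_powersetCard.1 hf
    refine card_image_le.trans ?_
    rcases (Y f).eq_empty_or_nonempty with hY | hY
    · simp [hY]
    have hd : Disjoint f (Y f) := disjoint_right.2 fun y hy => (mem_filter.1 hy).2.1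
    have hu : c (f ∪ Y f) := hc.union_of_forall_insert (by omega) hY fun y hy =>
      (mem_filter.1 hy).2.2
    have hcard := card_union_of_disjoint hd
    have := hY.card_pos
    have hYW : Y f ⊆ W := filter_subset _ _
    have := hmax _ (union_subset hfW hYW) (by omega) hu
    omega
  · rw [card_powersetCard]
    exact Nat.mul_le_mul_right _ (Nat.choose_le_pow _ _)

/-- There are few coloured `ℓ`-sets crossing between a maximum coloured subset `H` of `W` and its
complement. -/
lemma IsMajorityColoring.card_crossing_le (hc : IsMajorityColoring ℓ c) (hℓ : 2 ≤ ℓ)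
    {W H : Finset V} (hHW : H ⊆ W) (hH : c H) (hHl : ℓ ≤ H.card)
    (hmax : ∀ T ⊆ W, ℓ ≤ T.card → c T → T.card ≤ H.card) {F : Finset (Finset V)}
    (hF : ∀ e ∈ F, e ⊆ W ∧ e.card = ℓ ∧ c e ∧ ¬ e ⊆ H ∧ ¬ e ⊆ W \ H) :
    F.card ≤ (W \ H).card * W.card ^ (ℓ - 2) * ℓ := by
  classical
  let Y : Finset V → Finset V := fun f => H.filter fun y => c (insert y f)
  let P : Finset (Finset V) := (powersetCard (ℓ - 1) W).filter fun f => ¬ f ⊆ H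
  have hsub : F ⊆ P.biUnion fun f => (Y f).image fun y => insert y f := by
    intro e he
    obtain ⟨heW, hel, hce, heH, heR⟩ := hF e he
    obtain ⟨x, hxe, hxH⟩ := not_subset.1 heH
    obtain ⟨y, hye, hyR⟩ := not_subset.1 heR
    have hyH : y ∈ H := by
      by_contra hcon
      exact hyR (mem_sdiff.2 ⟨heW hye, hcon⟩)
    refine mem_biUnion.2 ⟨e.erase y, mem_filter.2 ⟨mem_powersetCard.2
      ⟨(erase_subset _ _).trans heW, by rw [card_erase_of_mem hye, hel]⟩, ?_⟩, ?_⟩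
    · intro hcon
      exact hxH (hcon (mem_erase.2 ⟨by rintro rfl; exact hxH hyH, hxe⟩))
    · refine mem_image.2 ⟨y, mem_filter.2 ⟨hyH, ?_⟩, insert_erase hye⟩
      rwa [insert_erase hye]
  have hP : P.card ≤ (W \ H).card * W.card ^ (ℓ - 2) := by
    have hPsub : P ⊆ (W \ H).biUnion fun x =>
        (powersetCard (ℓ - 2) W).image fun g => insert x g := by
      intro f hf
      obtain ⟨hf1, hfH⟩ := mem_filter.1 hf
      obtain ⟨hfW, hfl⟩ := mem_powersetCard.1 hf1
      obtain ⟨x, hxf, hxH⟩ := not_subset.1 hfH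
      refine mem_biUnion.2 ⟨x, mem_sdiff.2 ⟨hfW hxf, hxH⟩, mem_image.2 ⟨f.erase x,
        mem_powersetCard.2 ⟨(erase_subset _ _).trans hfW, ?_⟩, insert_erase hxf⟩⟩
      rw [card_erase_of_mem hxf, hfl]; omega
    refine (card_le_card hPsub).trans (card_biUnion_le_card_mul _ _ _ fun x _ => ?_)
    refine card_image_le.trans ?_
    rw [card_powersetCard]
    exact Nat.choose_le_pow _ _
  refine (card_le_card hsub).trans ((card_biUnion_le_card_mul _ _ ℓ ?_).trans
    (Nat.mul_le_mul_right _ hP))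
  intro f hf
  obtain ⟨hf1, hfH⟩ := mem_filter.1 hf
  obtain ⟨hfW, hfl⟩ := mem_powersetCard.1 hf1
  refine card_image_le.trans ?_
  by_contra! hcon
  have hYH : Y f ⊆ H := filter_subset _ _
  have hu : c (f ∪ Y f) := hc.union_of_forall_insert (by omega) (card_pos.1 (by omega))
    fun y hy => (mem_filter.1 hy).2
  have hle : (Y f).card ≤ ((f ∪ Y f) ∩ H).card :=
    card_le_card fun y hy => by simp [hy, hYH hy]
  have hu2 := hc.union hu hH (by omega)
  have hHsub : H ⊂ f ∪ Y f ∪ H := by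
    refine ⟨subset_union_right, fun hcon => hfH ?_⟩
    exact (subset_union_left.trans subset_union_left).trans hcon
  have hlt := card_lt_card hHsub
  have := hmax _ (union_subset (union_subset hfW (hYH.trans hHW)) hHW) (by omega) hu2
  omega

/-- The deletion method: a random subset of `W` with density `p`, minus one vertex from each
member of `F` it contains. -/
lemma exists_subset_forall_not_subset {W : Finset V} {F : Finset (Finset V)} (hℓ : 1 ≤ ℓ)
    (hF : ∀ e ∈ F, e ⊆ W ∧ e.card = ℓ) {p : ℝ} (hp0 : 0 ≤ p) (hp1 : p ≤ 1) :
    ∃ S ⊆ W, (∀ e ∈ F, ¬ e ⊆ S) ∧ p * W.card - p ^ ℓ * F.card ≤ S.card := by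
  classical
  let w : Finset V → ℝ := fun T => p ^ T.card * (1 - p) ^ (W \ T).card
  have hw0 : ∀ T, 0 ≤ w T := fun T =>
    mul_nonneg (pow_nonneg hp0 _) (pow_nonneg (by linarith) _)
  have hsup : ∀ e ⊆ W, ∑ T ∈ W.powerset, w T * (if e ⊆ T then 1 else 0) = p ^ e.card := by
    intro e he
    have h1 := prod_add (fun _ => p) (fun i => if i ∈ e then 0 else 1 - p) W
    have h2 : ∏ i ∈ W, (p + if i ∈ e then 0 else 1 - p) = p ^ e.card := by
      have : ∀ i ∈ W, (p + if i ∈ e then 0 else 1 - p) = if i ∈ e then p else 1 := fun i _ => by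
        split_ifs <;> ring
      rw [prod_congr rfl this, prod_ite_mem, prod_const, inter_eq_right.2 he]
    rw [← h2, h1]
    refine sum_congr rfl fun T _ => ?_
    rw [prod_const, mul_assoc]
    congr 1
    split_ifs with heT
    · rw [mul_one, ← prod_const]
      refine prod_congr rfl fun i hi => ?_
      rw [if_neg fun hie => (mem_sdiff.1 hi).2 (heT hie)]
    · obtain ⟨x, hxe, hxT⟩ := not_subset.1 heT
      rw [mul_zero, prod_eq_zero (mem_sdiff.2 ⟨he hxe, hxT⟩) (by simp [hxe])]
  have htot : ∑ T ∈ W.powerset, w T = 1 := by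
    simpa using hsup ∅ (empty_subset _)
  have hmean : ∑ T ∈ W.powerset, w T * ((T.card : ℝ) - (F.filter (· ⊆ T)).card)
      = p * W.card - p ^ ℓ * F.card := by
    simp only [mul_sub, sum_sub_distrib]
    congr 1
    · have : ∀ T ∈ W.powerset, w T * (T.card : ℝ)
          = ∑ x ∈ W, w T * (if {x} ⊆ T then 1 else 0) := by
        intro T hT
        rw [← mul_sum]
        simp [inter_eq_right.2 (mem_powerset.1 hT)]
      rw [sum_congr rfl this, sum_comm, sum_congr rfl fun x hx =>
        hsup {x} (singleton_subset_iff.2 hx)]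
      simp [mul_comm]
    · have : ∀ T ∈ W.powerset, w T * ((F.filter (· ⊆ T)).card : ℝ)
          = ∑ e ∈ F, w T * (if e ⊆ T then 1 else 0) := by
        intro T _
        rw [← mul_sum]
        simp
      rw [sum_congr rfl this, sum_comm, sum_congr rfl fun e he =>
        (hsup e (hF e he).1).trans (by rw [(hF e he).2])]
      simp [mul_comm]
  obtain ⟨T, hT, hTle⟩ : ∃ T ∈ W.powerset,
      p * W.card - p ^ ℓ * F.card ≤ (T.card : ℝ) - (F.filter (· ⊆ T)).card := by
    by_contra! hcon
    have hlt : ∑ T ∈ W.powerset, w T * ((T.card : ℝ) - (F.filter (· ⊆ T)).card)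
        < ∑ T ∈ W.powerset, w T * (p * W.card - p ^ ℓ * F.card) := by
      obtain ⟨T, hT, hwT⟩ : ∃ T ∈ W.powerset, 0 < w T :=
        exists_lt_of_sum_lt (by simp [htot])
      exact sum_lt_sum (fun T hT => mul_le_mul_of_nonneg_left (hcon T hT).le (hw0 T))
        ⟨T, hT, mul_lt_mul_of_pos_left (hcon T hT) hwT⟩
    rw [hmean, ← sum_mul, htot, one_mul] at hlt
    exact lt_irrefl _ hlt
  have hne : ∀ e ∈ F, ∃ s ⊆ e, s.card = 1 := fun e he =>
    exists_subset_card_eq (by rw [(hF e he).2]; omega)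
  choose! g hge hg using hne
  set D := (F.filter (· ⊆ T)).biUnion g
  refine ⟨T \ D, sdiff_subset.trans (mem_powerset.1 hT), ?_, ?_⟩
  · intro e he heS
    obtain ⟨x, hx⟩ := card_eq_one.1 (hg e he)
    have hxg : x ∈ g e := by simp [hx]
    exact (mem_sdiff.1 (heS (hge e he hxg))).2
      (mem_biUnion.2 ⟨e, mem_filter.2 ⟨he, heS.trans sdiff_subset⟩, hxg⟩)
  · refine hTle.trans ?_
    have h1 := le_card_sdiff D T
    have h2 : D.card ≤ (F.filter (· ⊆ T)).card * 1 :=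
      card_biUnion_le_card_mul _ _ _ fun e he => (hg e (mem_filter.1 he).1).le
    have h3 : T.card ≤ (T \ D).card + (F.filter (· ⊆ T)).card := by omega
    have h4 : (T.card : ℝ) ≤ (T \ D).card + (F.filter (· ⊆ T)).card := by exact_mod_cast h3
    linarith

lemma IsMajorityColoring.card_le_of_forall_card_lt (hc : IsMajorityColoring ℓ c) (hℓ : 2 ≤ ℓ)
    {m h : ℕ} (hm : ∀ S : Finset V, (∀ e ⊆ S, e.card = ℓ → ¬ c e) → S.card < m) {W : Finset V}
    (hh : 1 ≤ h) (hmax : ∀ T ⊆ W, ℓ ≤ T.card → c T → T.card ≤ h) :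
    W.card ≤ 2 ^ ℓ * m ^ (ℓ - 1) * h := by
  classical
  have hm0 : 0 < m := by simpa using (hm ∅ fun e he hel => by
    rw [subset_empty.1 he, card_empty] at hel; omega)
  obtain ⟨k, rfl⟩ : ∃ k, ℓ = k + 2 := ⟨ℓ - 2, by omega⟩
  rcases lt_or_ge W.card (2 * m) with hW | hW
  · refine hW.le.trans ?_
    calc 2 * m = 2 ^ 1 * m ^ 1 * 1 := by ring
      _ ≤ 2 ^ (k + 2) * m ^ (k + 2 - 1) * h := by gcongr <;> omega
  have hN : (0 : ℝ) < W.card := by exact_mod_cast (by omega : 0 < W.card)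
  set F := (powersetCard (k + 2) W).filter fun e => c e
  have hF : ∀ e ∈ F, e ⊆ W ∧ e.card = k + 2 ∧ c e := fun e he => by
    obtain ⟨h1, h2⟩ := mem_filter.1 he
    obtain ⟨h3, h4⟩ := mem_powersetCard.1 h1
    exact ⟨h3, h4, h2⟩
  obtain ⟨S, hSW, hSF, hS⟩ := exists_subset_forall_not_subset (p := 2 * m / W.card)
    (by omega) (fun e he => ⟨(hF e he).1, (hF e he).2.1⟩) (by positivity)
    ((div_le_one hN).2 (by exact_mod_cast hW))
  have hSm := hm S fun e he hel hce =>
    hSF e (mem_filter.2 ⟨mem_powersetCard.2 ⟨he.trans hSW, hel⟩, hce⟩) he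
  have hFcard : (F.card : ℝ) ≤ (W.card : ℝ) ^ (k + 1) * h := by
    exact_mod_cast hc.card_le (by omega) hmax hF
  have hSm' : (S.card : ℝ) < m := by exact_mod_cast hSm
  have h1 : (2 * m / W.card : ℝ) ^ (k + 2) * F.card ≤ (2 * m) ^ (k + 2) * h / W.card := by
    calc (2 * m / W.card : ℝ) ^ (k + 2) * F.card
        ≤ (2 * m / W.card : ℝ) ^ (k + 2) * ((W.card : ℝ) ^ (k + 1) * h) := by gcongr
      _ = (2 * m) ^ (k + 2) * h / W.card := by
        rw [div_pow, show (W.card : ℝ) ^ (k + 2) = W.card ^ (k + 1) * W.card by ring]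
        field_simp
  have h2 : (2 * m / W.card : ℝ) * W.card = 2 * m := by field_simp
  have h3 : (m : ℝ) < (2 * m) ^ (k + 2) * h / W.card := by linarith
  rw [lt_div_iff₀ hN, show (2 * m : ℝ) ^ (k + 2) * h = m * (2 ^ (k + 2) * m ^ (k + 1) * h) by
    ring] at h3
  have h4 := lt_of_mul_lt_mul_left h3 (by positivity)
  exact_mod_cast h4.le

lemma IsMajorityColoring.almostCograph_of_not (hc : IsMajorityColoring ℓ c) (hℓ : 3 ≤ ℓ)
    {m n : ℕ} (hm : ∀ S : Finset V, (∀ e ⊆ S, e.card = ℓ → ¬ c e) → S.card < m)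
    {W : Finset V} (hWn : W.card ≤ n) (hcW : ¬ c W)
    (ih : ∀ U ⊂ W, AlmostCograph ℓ c (ℓ * (2 ^ ℓ * m ^ (ℓ - 1)) * n ^ (ℓ - 3)) U) :
    AlmostCograph ℓ c (ℓ * (2 ^ ℓ * m ^ (ℓ - 1)) * n ^ (ℓ - 3)) W := by
  classical
  by_cases hleaf : ∀ e ⊆ W, e.card = ℓ → ¬ c e
  · exact almostCograph_of_forall_not (by omega) hleaf
  push Not at hleaf
  obtain ⟨e₀, he₀W, he₀l, he₀⟩ := hleaf
  obtain ⟨H, hHmem, hHmax⟩ := exists_max_image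
    (W.powerset.filter fun T => ℓ ≤ T.card ∧ c T) card
    ⟨e₀, mem_filter.2 ⟨mem_powerset.2 he₀W, he₀l.ge, he₀⟩⟩
  obtain ⟨hHW, hHl, hH⟩ := mem_filter.1 hHmem
  rw [mem_powerset] at hHW
  have hmax : ∀ T ⊆ W, ℓ ≤ T.card → c T → T.card ≤ H.card := fun T hT hl hcT =>
    hHmax T (mem_filter.2 ⟨mem_powerset.2 hT, hl, hcT⟩)
  have hHss : H ⊂ W := hHW.ssubset_of_ne (by rintro rfl; exact hcW hH)
  have hRss : W \ H ⊂ W := sdiff_ssubset hHW (card_pos.1 (by omega))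
  obtain ⟨F₁, hF₁, hF₁c, hU₁⟩ := ih H hHss
  obtain ⟨F₂, hF₂, hF₂c, hU₂⟩ := ih (W \ H) hRss
  set K := 2 ^ ℓ * m ^ (ℓ - 1)
  set F₀ := (powersetCard ℓ W).filter fun e => c e ∧ ¬ e ⊆ H ∧ ¬ e ⊆ W \ H
  have hF₀ : ∀ e ∈ F₀, e ⊆ W ∧ e.card = ℓ ∧ c e ∧ ¬ e ⊆ H ∧ ¬ e ⊆ W \ H := fun e he => by
    obtain ⟨h1, h2⟩ := mem_filter.1 he
    obtain ⟨h3, h4⟩ := mem_powersetCard.1 h1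
    exact ⟨h3, h4, h2⟩
  have hsum : (W \ H).card + H.card = W.card := card_sdiff_add_card_eq_card hHW
  refine ⟨F₀ ∪ F₁ ∪ F₂, ?_, ?_, ?_⟩
  · intro f hf
    simp only [mem_union] at hf
    rcases hf with (hf | hf) | hf
    · exact ⟨(hF₀ f hf).1, (hF₀ f hf).2.1⟩
    · exact ⟨(hF₁ f hf).1.trans hHW, (hF₁ f hf).2⟩
    · exact ⟨(hF₂ f hf).1.trans sdiff_subset, (hF₂ f hf).2⟩
  · have hWK : W.card ≤ K * H.card :=
      hc.card_le_of_forall_card_lt (by omega) hm (by omega) hmax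
    have hF₀c : F₀.card ≤ ℓ * K * n ^ (ℓ - 3) * ((W \ H).card * H.card) := by
      calc F₀.card ≤ (W \ H).card * W.card ^ (ℓ - 2) * ℓ :=
            hc.card_crossing_le (by omega) hHW hH hHl hmax hF₀
        _ = ℓ * W.card * W.card ^ (ℓ - 3) * (W \ H).card := by
            rw [show ℓ - 2 = ℓ - 3 + 1 by omega]; ring
        _ ≤ ℓ * (K * H.card) * n ^ (ℓ - 3) * (W \ H).card := by gcongr
        _ = _ := by ring
    calc (F₀ ∪ F₁ ∪ F₂).card ≤ F₀.card + F₁.card + F₂.card :=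
          (card_union_le _ _).trans (Nat.add_le_add_right (card_union_le _ _) _)
      _ ≤ ℓ * K * n ^ (ℓ - 3) * ((W \ H).card * H.card) + ℓ * K * n ^ (ℓ - 3) * H.card ^ 2
          + ℓ * K * n ^ (ℓ - 3) * (W \ H).card ^ 2 := by gcongr
      _ = ℓ * K * n ^ (ℓ - 3) * ((W \ H).card * H.card + H.card ^ 2 + (W \ H).card ^ 2) := by ring
      _ ≤ ℓ * K * n ^ (ℓ - 3) * W.card ^ 2 := by
        gcongr
        rw [← hsum]
        nlinarith [Nat.zero_le ((W \ H).card * H.card)]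
  · intro U hUW hUF
    obtain ⟨A₁, hA₁, B₁, hB₁, hA₁c, hB₁c, h₁⟩ := hU₁ (U ∩ H) inter_subset_right fun f hf hfU =>
      hUF f (by simp [hf]) (hfU.trans inter_subset_left)
    obtain ⟨A₂, hA₂, B₂, hB₂, hA₂c, hB₂c, h₂⟩ := hU₂ (U \ H) (sdiff_subset_sdiff hUW subset_rfl)
      fun f hf hfU => hUF f (by simp [hf]) (hfU.trans sdiff_subset)
    have hAU : A₁ ∪ A₂ ⊆ U := union_subset (hA₁.trans inter_subset_left) (hA₂.trans sdiff_subset)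
    have hAH : ∀ x ∈ A₁, x ∈ H := fun x hx => (mem_inter.1 (hA₁ hx)).2
    have hAR : ∀ x ∈ A₂, x ∉ H := fun x hx => (mem_sdiff.1 (hA₂ hx)).2
    have hAd : Disjoint A₁ A₂ := disjoint_left.2 fun x hx hx' => hAR x hx' (hAH x hx)
    have hAc : ∀ e ⊆ A₁ ∪ A₂, e.card = ℓ → ¬ c e := by
      intro e he hel hce
      by_cases h1 : e ⊆ H
      · refine hA₁c e (fun x hx => ?_) hel hce
        exact (mem_union.1 (he hx)).resolve_right fun hx2 => hAR x hx2 (h1 hx)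
      by_cases h2 : e ⊆ W \ H
      · refine hA₂c e (fun x hx => ?_) hel hce
        exact (mem_union.1 (he hx)).resolve_left fun hx2 =>
          (mem_sdiff.1 (h2 hx)).2 (hAH x hx2)
      refine hUF e ?_ (he.trans hAU)
      simp only [mem_union]
      exact Or.inl (Or.inl (mem_filter.2
        ⟨mem_powersetCard.2 ⟨(he.trans hAU).trans hUW, hel⟩, hce, h1, h2⟩))
    have hUc := card_inter_add_card_sdiff U H
    have hcard : ∀ b, B₁.card ≤ b → B₂.card ≤ b → U.card ≤ (A₁ ∪ A₂).card * b := by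
      intro b hb1 hb2
      rw [card_union_of_disjoint hAd, ← hUc, add_mul]
      exact add_le_add (h₁.trans (Nat.mul_le_mul_left _ hb1))
        (h₂.trans (Nat.mul_le_mul_left _ hb2))
    rcases le_total B₁.card B₂.card with hB | hB
    · exact ⟨_, hAU, B₂, hB₂.trans sdiff_subset, hAc, hB₂c, hcard _ hB le_rfl⟩
    · exact ⟨_, hAU, B₁, hB₁.trans inter_subset_left, hAc, hB₁c, hcard _ le_rfl hB⟩

lemma IsMajorityColoring.almostCograph (hc : IsMajorityColoring ℓ c) (hℓ : 3 ≤ ℓ)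
    {m n : ℕ} (hm : ∀ S : Finset V, (∀ e ⊆ S, e.card = ℓ → ¬ c e) → S.card < m)
    (hm' : ∀ S : Finset V, (∀ e ⊆ S, e.card = ℓ → c e) → S.card < m) (W : Finset V)
    (hWn : W.card ≤ n) : AlmostCograph ℓ c (ℓ * (2 ^ ℓ * m ^ (ℓ - 1)) * n ^ (ℓ - 3)) W := by
  induction W using Finset.strongInduction with
  | H W ih =>
  have ih' := fun U (hU : U ⊂ W) => ih U hU ((card_le_card hU.subset).trans hWn)
  by_cases hcW : c W
  · have := (hc.compl.almostCograph_of_not hℓ (fun S hS => hm' S fun e he hel =>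
      not_not.1 (hS e he hel)) hWn (not_not.2 hcW) fun U hU => (ih' U hU).compl).compl
    simpa only [not_not] using this
  · exact hc.almostCograph_of_not hℓ hm hWn hcW ih'

lemma IsMajorityColoring.card_univ_le [Fintype V] (hc : IsMajorityColoring ℓ c) (hℓ : 3 ≤ ℓ)
    {m : ℕ} (hm : ∀ S : Finset V, (∀ e ⊆ S, e.card = ℓ → ¬ c e) → S.card < m)
    (hm' : ∀ S : Finset V, (∀ e ⊆ S, e.card = ℓ → c e) → S.card < m) :
    Fintype.card V ≤ ℓ * 4 ^ ℓ * m ^ (3 * ℓ - 3) := by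
  have hm0 : 0 < m := by simpa using (hm ∅ fun e he hel => by
    rw [subset_empty.1 he, card_empty] at hel; omega)
  obtain ⟨F, hF, hFc, hU⟩ := hc.almostCograph hℓ hm hm' univ le_rfl
  rw [card_univ] at hFc
  set n := Fintype.card V with hn
  obtain ⟨k, rfl⟩ : ∃ k, ℓ = k + 3 := ⟨ℓ - 3, by omega⟩
  simp only [show k + 3 - 1 = k + 2 by omega, show k + 3 - 3 = k by omega,
    show 3 * (k + 3) - 3 = 3 * k + 6 by omega] at *
  rcases lt_or_ge n (2 * m ^ 2) with hlt | hge
  · refine hlt.le.trans ?_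
    gcongr ?_ * ?_
    · calc 2 ≤ 3 * 4 ^ 1 := by norm_num
        _ ≤ (k + 3) * 4 ^ (k + 3) := by gcongr <;> omega
    · exact Nat.pow_le_pow_right hm0 (by omega)
  have hn0 : (0 : ℝ) < n := by exact_mod_cast (lt_of_lt_of_le (by positivity) hge)
  obtain ⟨S, -, hSF, hS⟩ := exists_subset_forall_not_subset (p := 2 * m ^ 2 / n)
    (by omega) hF (by positivity) ((div_le_one hn0).2 (by exact_mod_cast hge))
  obtain ⟨A, -, B, -, hA, hB, hAB⟩ := hU S (subset_univ _) hSF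
  have hSm : (S.card : ℝ) < m ^ 2 := by
    have : S.card < m ^ 2 := by
      rw [sq]; exact hAB.trans_lt (Nat.mul_lt_mul'' (hm A hA) (hm' B hB))
    exact_mod_cast this
  have hFc' : (F.card : ℝ) ≤ (k + 3) * (2 ^ (k + 3) * m ^ (k + 2)) * n ^ k * n ^ 2 := by
    exact_mod_cast hFc
  rw [card_univ, ← hn, div_mul_cancel₀ _ hn0.ne'] at hS
  have h1 : (2 * m ^ 2 / n : ℝ) ^ (k + 3) * F.card
      ≤ m ^ 2 * ((k + 3) * 4 ^ (k + 3) * m ^ (3 * k + 6)) / n := by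
    calc (2 * m ^ 2 / n : ℝ) ^ (k + 3) * F.card
        ≤ (2 * m ^ 2 / n : ℝ) ^ (k + 3) *
          ((k + 3) * (2 ^ (k + 3) * m ^ (k + 2)) * n ^ k * n ^ 2) := by gcongr
      _ = m ^ 2 * ((k + 3) * 4 ^ (k + 3) * m ^ (3 * k + 6)) / n := by
        rw [div_pow, show (n : ℝ) ^ (k + 3) = n ^ k * n ^ 2 * n by ring,
          show (4 : ℝ) = 2 * 2 by norm_num, mul_pow 2 2]
        field_simp
        ring
  have h2 : (m : ℝ) ^ 2 < m ^ 2 * ((k + 3) * 4 ^ (k + 3) * m ^ (3 * k + 6)) / n := by linarith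
  rw [lt_div_iff₀ hn0] at h2
  have h3 := lt_of_mul_lt_mul_left h2 (by positivity)
  exact_mod_cast h3.le

end Coloring

/-- the Erdős–Hajnal property for disperse hypergraphs. -/
theorem disperse_EH (ℓ : ℕ) (hℓ : 3 ≤ ℓ) :
    ∃ c : ℝ, 0 < c ∧
      ∀ (V : Type) (_ : DecidableEq V) (_ : Fintype V) (E : Finset (Finset V)),
        (∀ e ∈ E, e.card = ℓ) → Disperse ℓ E →
        ∃ S : Finset V,
          ((∀ e ∈ E, ¬ e ⊆ S) ∨ (∀ e : Finset V, e ⊆ S → e.card = ℓ → e ∈ E)) ∧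
          c * (Fintype.card V : ℝ) ^ ((1 : ℝ) / (3 * (ℓ : ℝ) - 1)) ≤ S.card := by
  set C : ℝ := ℓ * 4 ^ ℓ with hC
  have hC1 : 1 ≤ C := by
    have h1 : (1 : ℝ) ≤ ℓ := by exact_mod_cast (by omega : 1 ≤ ℓ)
    have h2 : (1 : ℝ) ≤ 4 ^ ℓ := one_le_pow₀ (by norm_num)
    nlinarith
  have hd : (0 : ℝ) < 3 * (ℓ : ℝ) - 1 := by
    have : (3 : ℝ) ≤ ℓ := by exact_mod_cast hℓ
    linarith
  refine ⟨1 / (2 * C), by positivity, fun V _ _ E hE hD => ?_⟩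
  classical
  obtain ⟨c, hc, hcE⟩ := hD.exists_isMajorityColoring hℓ hE
  let P : Finset V → Prop := fun S =>
    (∀ e ∈ E, ¬ e ⊆ S) ∨ (∀ e : Finset V, e ⊆ S → e.card = ℓ → e ∈ E)
  rcases isEmpty_or_nonempty V with hV | ⟨⟨v⟩⟩
  · refine ⟨∅, Or.inr fun e he hel => ?_, ?_⟩
    · rw [subset_empty.1 he, card_empty] at hel; omega
    · rw [Fintype.card_eq_zero, Nat.cast_zero, Real.zero_rpow (by positivity)]
      simp
  have hPv : P {v} := Or.inr fun e he hel => by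
    have := card_le_card he
    rw [card_singleton] at this
    omega
  obtain ⟨S, hSP, hSmax⟩ := exists_max_image (univ.filter P) card ⟨{v}, by simpa using hPv⟩
  have hS1 : 1 ≤ S.card := by simpa using hSmax {v} (by simpa using hPv)
  refine ⟨S, (mem_filter.1 hSP).2, ?_⟩
  have hlt : ∀ T, P T → T.card < S.card + 1 := fun T hT =>
    Nat.lt_succ_of_le (hSmax T (by simpa using hT))
  have hn := hc.card_univ_le hℓ (m := S.card + 1)
    (fun T hT => hlt T (Or.inl fun e he heT => hT e heT (hE e he) ((hcE e (hE e he)).2 he)))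
    (fun T hT => hlt T (Or.inr fun e he hel => (hcE e hel).1 (hT e he hel)))
  set s := S.card with hs
  have hs0 : (1 : ℝ) ≤ s := by exact_mod_cast hS1
  have hn' : (Fintype.card V : ℝ) ≤ (C * (2 * s)) ^ (3 * (ℓ : ℝ) - 1) := by
    calc (Fintype.card V : ℝ)
        ≤ C * ((s : ℝ) + 1) ^ (3 * ℓ - 3) := by
          rw [hC]
          exact_mod_cast hn
      _ ≤ C ^ (3 * ℓ - 1) * (2 * s) ^ (3 * ℓ - 1) := by
        gcongr ?_ * ?_
        · exact le_self_pow₀ hC1 (by omega)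
        · calc ((s : ℝ) + 1) ^ (3 * ℓ - 3) ≤ (s + 1) ^ (3 * ℓ - 1) :=
                pow_le_pow_right₀ (by linarith) (by omega)
            _ ≤ (2 * s) ^ (3 * ℓ - 1) := by gcongr; linarith
      _ = (C * (2 * s)) ^ (3 * (ℓ : ℝ) - 1) := by
        rw [← mul_pow, ← Real.rpow_natCast, Nat.cast_sub (by omega)]
        push_cast
        rfl
  have hroot : (Fintype.card V : ℝ) ^ ((1 : ℝ) / (3 * (ℓ : ℝ) - 1)) ≤ C * (2 * s) := by
    calc (Fintype.card V : ℝ) ^ ((1 : ℝ) / (3 * (ℓ : ℝ) - 1))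
        ≤ ((C * (2 * s)) ^ (3 * (ℓ : ℝ) - 1)) ^ ((1 : ℝ) / (3 * (ℓ : ℝ) - 1)) := by gcongr
      _ = C * (2 * s) := by
        rw [← Real.rpow_mul (by positivity), mul_one_div_cancel hd.ne', Real.rpow_one]
  calc 1 / (2 * C) * (Fintype.card V : ℝ) ^ ((1 : ℝ) / (3 * (ℓ : ℝ) - 1))
      ≤ 1 / (2 * C) * (C * (2 * s)) := by gcongr
    _ = s := by field_simp
end
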